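/- arXiv:1708.05266 — 5 statements merged into one kernel-verified Lean document; each statement's English description precedes it below -/
import Mathlib

section
/- Let p be a rational prime with p ≡ 4 or 7 (mod 9) such that 3 is not a cubic residue modulo p. Then the Mordell–Weil group E_{3p²}(ℚ) has rank 0; that is, ℚ ⊗_ℤ E_{3p²}(ℚ) = 0, equivalently every rational point of E_{3p²} is a torsion point. -/
open TensorProduct

/-- The elliptic curve `E_n : y² = x³ - 432 n²` over `ℚ`,
a Weierstrass model of the cubic curve `x³ + y³ = n`. -/
noncomputable def Ecurve (n : ℚ) : WeierstrassCurve.Affine ℚ :=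
  { a₁ := 0, a₂ := 0, a₃ := 0, a₄ := 0, a₆ := -432 * n ^ 2 }

section CubicCharacter

variable {F R : Type*} [Field F] [CommRing R] {ω : R}

theorem IsPrimitiveRoot.sq_add_self_add_one [IsDomain R] (hω : IsPrimitiveRoot ω 3) :
    ω ^ 2 + ω + 1 = 0 := by
  have h := hω.isRoot_cyclotomic (by norm_num)
  simpa [Polynomial.cyclotomic_three, Polynomial.IsRoot] using h

theorem IsPrimitiveRoot.eq_of_pow_three_eq_one [IsDomain R] (hω : IsPrimitiveRoot ω 3) {x : R}
    (hx : x ^ 3 = 1) : x = 1 ∨ x = ω ∨ x = ω ^ 2 := by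
  obtain ⟨i, hi, rfl⟩ := hω.eq_pow_of_pow_eq_one hx
  interval_cases i <;> simp

theorem MulChar.apply_pow_three {χ : MulChar F R} (hχ : χ ^ 3 = 1) {t : F} (ht : t ≠ 0) :
    χ t ^ 3 = 1 := by
  rw [← MulChar.pow_apply' χ three_ne_zero, hχ, MulChar.one_apply ht.isUnit]

open Classical in
/-- The indicator function of the level set `χ = u`. -/
noncomputable def levelIndicator (χ : MulChar F R) (u : R) (t : F) : R :=
  if χ t = u then 1 else 0

theorem levelIndicator_of_eq {χ : MulChar F R} {u : R} {t : F} (h : χ t = u) :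
    levelIndicator χ u t = 1 := if_pos h

theorem levelIndicator_of_ne {χ : MulChar F R} {u : R} {t : F} (h : χ t ≠ u) :
    levelIndicator χ u t = 0 := if_neg h

variable [IsDomain R]

theorem cubicChar_eq_levelIndicator (hω : IsPrimitiveRoot ω 3) {χ : MulChar F R}
    (hχ : χ ^ 3 = 1) (t : F) :
    χ t = levelIndicator χ 1 t + ω * levelIndicator χ ω t + ω ^ 2 * levelIndicator χ (ω ^ 2) t ∧
    χ⁻¹ t = levelIndicator χ 1 t + ω ^ 2 * levelIndicator χ ω t
      + ω * levelIndicator χ (ω ^ 2) t := by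
  have h0 : ω ≠ 0 := hω.ne_zero (by norm_num)
  have h1 : ω ≠ 1 := hω.ne_one (by norm_num)
  have h3 : ω ^ 3 = 1 := hω.pow_eq_one
  have h2 : ω ^ 2 ≠ 1 := hω.pow_ne_one_of_pos_of_lt (by norm_num) (by norm_num)
  have h12 : ω ^ 2 ≠ ω := fun h ↦ h1 (mul_left_cancel₀ h0 (by linear_combination h))
  by_cases ht : t = 0
  · subst ht
    have h (ψ : MulChar F R) : ψ 0 = 0 := ψ.map_zero
    rw [levelIndicator_of_ne (by simp [h]), levelIndicator_of_ne (by simpa [h] using h0.symm),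
      levelIndicator_of_ne (by simpa [h] using (pow_ne_zero 2 h0).symm), h, h]
    simp
  · have hi : χ⁻¹ t = χ t ^ 2 := by
      have : χ⁻¹ = χ ^ 2 := inv_eq_of_mul_eq_one_left (by rw [← pow_succ, hχ])
      rw [this, MulChar.pow_apply' χ two_ne_zero]
    rw [hi]
    rcases hω.eq_of_pow_three_eq_one (MulChar.apply_pow_three hχ ht) with h | h | h
    · rw [levelIndicator_of_eq h, levelIndicator_of_ne (h ▸ h1.symm),
        levelIndicator_of_ne (h ▸ h2.symm), h]
      simp
    · rw [levelIndicator_of_eq h, levelIndicator_of_ne (h ▸ h1),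
        levelIndicator_of_ne (h ▸ h12.symm), h]
      simp
    · rw [levelIndicator_of_eq h, levelIndicator_of_ne (h ▸ h2),
        levelIndicator_of_ne (h ▸ h12), h]
      exact ⟨by ring, by linear_combination ω * h3⟩

variable [Fintype F]

/-- The sum of `ψ` over the level set `χ = u`. -/
noncomputable def gaussPeriod (χ : MulChar F R) (ψ : AddChar F R) (u : R) : R :=
  ∑ t, levelIndicator χ u t * ψ t

theorem gaussSum_eq_gaussPeriod (hω : IsPrimitiveRoot ω 3) {χ : MulChar F R}
    (hχ : χ ^ 3 = 1) (ψ : AddChar F R) :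
    gaussSum χ ψ = gaussPeriod χ ψ 1 + ω * gaussPeriod χ ψ ω + ω ^ 2 * gaussPeriod χ ψ (ω ^ 2) ∧
    gaussSum χ⁻¹ ψ = gaussPeriod χ ψ 1 + ω ^ 2 * gaussPeriod χ ψ ω
      + ω * gaussPeriod χ ψ (ω ^ 2) := by
  simp only [gaussSum, gaussPeriod, Finset.mul_sum, ← Finset.sum_add_distrib]
  constructor <;> refine Finset.sum_congr rfl fun t _ ↦ ?_
  · rw [(cubicChar_eq_levelIndicator hω hχ t).1]; ring
  · rw [(cubicChar_eq_levelIndicator hω hχ t).2]; ring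

theorem exists_jacobiSum_eq (hω : IsPrimitiveRoot ω 3) {χ : MulChar F R} (hχ : χ ^ 3 = 1) :
    ∃ c d : ℤ, jacobiSum χ χ = c + d * ω ∧ jacobiSum χ⁻¹ χ⁻¹ = c + d * ω ^ 2 := by
  classical
  have key (u : R) : ∃ n : ℤ, ∑ x : F, levelIndicator χ u (x * (1 - x)) = n :=
    ⟨(Finset.univ.filter fun x : F ↦ χ (x * (1 - x)) = u).card, by simp [levelIndicator]⟩
  obtain ⟨a, ha⟩ := key 1
  obtain ⟨b, hb⟩ := key ω
  obtain ⟨c, hc⟩ := key (ω ^ 2)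
  have hs := hω.sq_add_self_add_one
  refine ⟨a - c, b - c, ?_, ?_⟩
  · have : jacobiSum χ χ = a + ω * b + ω ^ 2 * c := by
      simp only [jacobiSum, ← ha, ← hb, ← hc, Finset.mul_sum, ← Finset.sum_add_distrib,
        ← map_mul]
      exact Finset.sum_congr rfl fun x _ ↦ (cubicChar_eq_levelIndicator hω hχ _).1
    rw [this]; push_cast; linear_combination c * hs
  · have : jacobiSum χ⁻¹ χ⁻¹ = a + ω ^ 2 * b + ω * c := by
      simp only [jacobiSum, ← ha, ← hb, ← hc, Finset.mul_sum, ← Finset.sum_add_distrib,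
        ← map_mul]
      exact Finset.sum_congr rfl fun x _ ↦ (cubicChar_eq_levelIndicator hω hχ _).2
    rw [this]; push_cast; linear_combination c * hs

theorem sum_pow_three_of_three_eq_zero {Q ι : Type*} [CommRing Q] (h3 : (3 : Q) = 0)
    (s : Finset ι) (f : ι → Q) : (∑ i ∈ s, f i) ^ 3 = ∑ i ∈ s, f i ^ 3 := by
  classical
  induction s using Finset.induction_on with
  | empty => simp
  | insert a s ha ih =>
    rw [Finset.sum_insert ha, Finset.sum_insert ha, ← ih]
    linear_combination (f a ^ 2 * (∑ i ∈ s, f i) + f a * (∑ i ∈ s, f i) ^ 2) * h3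

theorem map_gaussPeriod_pow_three {Q : Type*} [CommRing Q] (h3 : (3 : Q) = 0) (f : R →+* Q)
    {χ : MulChar F R} (hχ : χ ^ 3 = 1) (hF : (3 : F) ≠ 0) (ψ : AddChar F R) (u : R) :
    f (gaussPeriod χ ψ u) ^ 3 = f (gaussPeriod χ ψ (χ 3 * u)) := by
  have hχ3 : χ 3 ≠ 0 := fun h ↦ by simpa [h] using MulChar.apply_pow_three hχ hF
  simp only [gaussPeriod, map_sum]
  rw [sum_pow_three_of_three_eq_zero h3, ← Equiv.sum_comp (Equiv.mulLeft₀ (3 : F) hF)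
    (fun t ↦ f (levelIndicator χ (χ 3 * u) t * ψ t))]
  refine Finset.sum_congr rfl fun t _ ↦ ?_
  have h1 : levelIndicator χ (χ 3 * u) (3 * t) = levelIndicator χ u t := by
    by_cases h : χ t = u
    · rw [levelIndicator_of_eq h, levelIndicator_of_eq (by rw [map_mul, h])]
    · rw [levelIndicator_of_ne h, levelIndicator_of_ne]
      rw [map_mul]
      exact fun h' ↦ h (mul_left_cancel₀ hχ3 h')
  have h2 : ψ (3 * t) = ψ t ^ 3 := by
    rw [← AddChar.map_nsmul_eq_pow]; simp
  have h3 : levelIndicator χ u t ^ 3 = levelIndicator χ u t := by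
    simp [levelIndicator]
  rw [show Equiv.mulLeft₀ 3 hF t = 3 * t from rfl, h1, h2, ← map_pow, mul_pow, h3]

theorem MulChar.exists_pow_three_eq {χ : MulChar F R} (hχ : χ ^ 3 = 1) (hχ1 : χ ≠ 1) {t : F}
    (ht : χ t = 1) : ∃ x, x ^ 3 = t := by
  have ht0 : t ≠ 0 := by rintro rfl; simp at ht
  obtain ⟨g, hg⟩ := IsCyclic.exists_generator (α := Fˣ)
  obtain ⟨m, hm⟩ := Subgroup.mem_zpowers_iff.1 (hg (Units.mk0 t ht0))
  have hgχ : χ g ≠ 1 := fun h ↦ hχ1 <| MulChar.ext fun a ↦ by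
    obtain ⟨k, rfl⟩ := Subgroup.mem_zpowers_iff.1 (hg a)
    have : χ.toUnitHom g = 1 := Units.ext (by simpa using h)
    rw [MulChar.one_apply_coe, ← MulChar.coe_toUnitHom, map_zpow, this, one_zpow, Units.val_one]
  have h3 : χ.toUnitHom g ^ 3 = 1 := Units.ext (by
    simpa using MulChar.apply_pow_three hχ g.ne_zero)
  have hm1 : χ.toUnitHom g ^ m = 1 := by
    rw [← map_zpow, hm]; exact Units.ext (by simpa using ht)
  have ho : orderOf (χ.toUnitHom g) = 3 := orderOf_eq_prime h3 fun h ↦ hgχ (by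
    rw [← MulChar.coe_toUnitHom, h, Units.val_one])
  obtain ⟨k, rfl⟩ : (3 : ℤ) ∣ m := by
    have := orderOf_dvd_iff_zpow_eq_one.2 hm1
    rwa [ho] at this
  refine ⟨((g ^ k : Fˣ) : F), ?_⟩
  have : (g ^ k) ^ 3 = Units.mk0 t ht0 := by rw [← hm, mul_comm, zpow_mul]; rfl
  rw [← Units.val_pow_eq_pow_val, this, Units.val_mk0]

end CubicCharacter

theorem eq_zero_of_artinSchreier_differences {Q : Type*} [CommRing Q] (h3 : (3 : Q) = 0)
    {x y z : Q} (hx : x ^ 3 = y) (hy : y ^ 3 = z) (hz : z ^ 3 = x)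
    (h : (x - y) * (y - z) * (z - x) = 0) : x - y = 0 ∧ y - z = 0 := by
  have cube (a b : Q) : (a - b) ^ 3 = a ^ 3 - b ^ 3 := by
    linear_combination (-a ^ 2 * b + a * b ^ 2) * h3
  have h1 : (x - y) ^ 3 = y - z := by rw [cube, hx, hy]
  have h2 : (y - z) ^ 3 = z - x := by rw [cube, hy, hz]
  have h4 : (z - x) ^ 3 = x - y := by rw [cube, hz, hx]
  have h13 : (x - y) ^ 13 = 0 := by
    rw [← h, ← h2, ← h1]; ring
  have h0 : x - y = 0 := by
    rw [← h4, ← h2, ← h1]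
    linear_combination (x - y) ^ 14 * h13
  exact ⟨h0, by rw [← h1, h0]; ring⟩

theorem exists_norm_form_of_not_cube {p : ℕ} (hp : p.Prime) (hp1 : p % 3 = 1)
    (hcube : ¬ ∃ x : ℤ, (x : ZMod p) ^ 3 = 3) :
    ∃ c d : ℤ, c ^ 2 - c * d + d ^ 2 = p ∧ 3 ∣ d ∧ ¬ 9 ∣ d := by
  have : Fact p.Prime := ⟨hp⟩
  let R := integralClosure ℤ ℂ
  have hdvd : ∀ m n : ℤ, m ≠ 0 → (m : R) ∣ n → m ∣ n := by
    rintro m n hm ⟨r, hr⟩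
    have hr' : (n : ℂ) = m * (r : ℂ) := by exact_mod_cast congrArg (Subtype.val) hr
    have hm' : (m : ℂ) ≠ 0 := by exact_mod_cast hm
    have hq : (r : ℂ) = algebraMap ℚ ℂ (n / m) := by
      rw [map_div₀]; simp [hr', hm']
    have hi : IsIntegral ℤ ((n : ℚ) / m) := by
      rw [← isIntegral_algebraMap_iff (algebraMap ℚ ℂ).injective (B := ℂ), ← hq]
      exact r.2
    obtain ⟨y, hy⟩ := IsIntegrallyClosed.isIntegral_iff.1 hi
    refine ⟨y, ?_⟩
    have hm'' : (m : ℚ) ≠ 0 := by exact_mod_cast hm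
    rw [eq_div_iff hm''] at hy
    have : (y : ℚ) * m = n := hy
    have h' : y * m = n := by exact_mod_cast this
    rw [← h', mul_comm]
  have root (n : ℕ) (hn : n ≠ 0) : ∃ z : R, IsPrimitiveRoot z n := by
    have h := Complex.isPrimitiveRoot_exp n hn
    exact ⟨⟨_, h.isIntegral (Nat.pos_of_ne_zero hn)⟩,
      IsPrimitiveRoot.coe_submonoidClass_iff.1 h⟩
  obtain ⟨ω, hω⟩ := root 3 (by norm_num)
  obtain ⟨ζ, hζ⟩ := root p hp.ne_zero
  have hψ := AddChar.zmodChar_primitive_of_primitive_root p hζ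
  set ψ := AddChar.zmodChar p ((IsPrimitiveRoot.iff_def ζ p).mp hζ).left
  obtain ⟨χ, hχo⟩ := MulChar.exists_mulChar_orderOf (ZMod p) (n := 3)
    (by rw [ZMod.card]; omega) hω
  have hχ : χ ^ 3 = 1 := hχo ▸ pow_orderOf_eq_one χ
  have hχ1 : χ ≠ 1 := by rintro rfl; simp at hχo
  have hχi : χ⁻¹ ^ 3 = 1 := by rw [inv_pow, hχ, inv_one]
  have hχio : orderOf χ⁻¹ = 3 := by rw [orderOf_inv, hχo]
  have hneg : χ (-1) = 1 := by
    have h := MulChar.apply_pow_three hχ (t := -1) (by simp)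
    rwa [← map_pow, show (-1 : ZMod p) ^ 3 = -1 by ring] at h
  have hnegi : χ⁻¹ (-1) = 1 := by
    have h := MulChar.apply_pow_three hχi (t := -1) (by simp)
    rwa [← map_pow, show (-1 : ZMod p) ^ 3 = -1 by ring] at h
  obtain ⟨c, d, hJ, hJ'⟩ := exists_jacobiSum_eq hω hχ
  have hg3 : gaussSum χ ψ ^ 3 = p * (c + d * ω) := by
    have := gaussSum_pow_eq_prod_jacobiSum (χ := χ) (ψ := ψ) (by omega) hψ
    simpa [hχo, hneg, hJ] using this
  have hg3' : gaussSum χ⁻¹ ψ ^ 3 = p * (c + d * ω ^ 2) := by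
    have := gaussSum_pow_eq_prod_jacobiSum (χ := χ⁻¹) (ψ := ψ) (by omega) hψ
    simpa [hχio, hnegi, hJ'] using this
  have hgg : gaussSum χ ψ * gaussSum χ⁻¹ ψ = p := by
    have := gaussSum_mul_gaussSum_eq_card hχ1 hψ
    rw [← mul_gaussSum_inv_eq_gaussSum χ⁻¹ ψ, hnegi, one_mul, this, ZMod.card]
  obtain ⟨hg, hg'⟩ := gaussSum_eq_gaussPeriod hω hχ ψ
  set x := gaussPeriod χ ψ 1
  set y := gaussPeriod χ ψ ω
  set z := gaussPeriod χ ψ (ω ^ 2)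
  have hs := hω.sq_add_self_add_one
  have h3 : ω ^ 3 = 1 := hω.pow_eq_one
  replace hg : gaussSum χ ψ = (x - z) + ω * (y - z) := by linear_combination hg + z * hs
  replace hg' : gaussSum χ⁻¹ ψ = (x - z) + ω ^ 2 * (y - z) := by
    linear_combination hg' + z * hs
  have hp0 : (p : R) ≠ 0 := by exact_mod_cast hp.ne_zero
  have hp3 : ¬ 3 ∣ (p : ℤ) := by omega
  have hnorm : c ^ 2 - c * d + d ^ 2 = p := by
    have h : (p : R) ^ 2 * (c ^ 2 - c * d + d ^ 2 - p) = 0 := by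
      have e : (gaussSum χ ψ * gaussSum χ⁻¹ ψ) ^ 3 = (p : R) ^ 3 := by rw [hgg]
      rw [mul_pow, hg3, hg3'] at e
      linear_combination e - p ^ 2 * c * d * hs - p ^ 2 * d ^ 2 * h3
    have h' := (mul_eq_zero.1 h).resolve_left (pow_ne_zero _ hp0)
    have : (c ^ 2 - c * d + d ^ 2 - p : ℤ) = 0 := by exact_mod_cast h'
    linarith
  have hω2 : ω - ω ^ 2 ≠ 0 := fun h ↦ hω.ne_one (by norm_num)
    (mul_left_cancel₀ (hω.ne_zero (by norm_num)) (by linear_combination -h))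
  have hD : 3 * ((x - y) * (y - z) * (z - x)) = -(p * d : R) := by
    apply mul_left_cancel₀ hω2
    have e := congrArg₂ (· - ·) hg3 hg3'
    simp only [hg, hg'] at e
    linear_combination -e - (3 * (x - z) * (y - z) ^ 2 * ω + (y - z) ^ 3 * ω ^ 3) * h3
  have hd3 : 3 ∣ d := by
    have : (3 : ℤ) ∣ p * d := by
      apply hdvd 3 (p * d) (by norm_num)
      exact ⟨-((x - y) * (y - z) * (z - x)), by push_cast; linear_combination hD⟩
    exact (Int.Prime.dvd_mul' Nat.prime_three this).resolve_left hp3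
  refine ⟨c, d, hnorm, hd3, ?_⟩
  rintro ⟨e, rfl⟩
  have hD' : (3 : R) ∣ (x - y) * (y - z) * (z - x) := by
    refine ⟨-(p * e), mul_left_cancel₀ (show (3 : R) ≠ 0 by norm_num) ?_⟩
    push_cast at hD
    linear_combination hD
  let f := Ideal.Quotient.mk (Ideal.span {(3 : R)})
  have hf (r : R) : f r = 0 ↔ 3 ∣ r := Ideal.Quotient.eq_zero_iff_dvd _ _
  have hQ3 : (3 : R ⧸ Ideal.span {(3 : R)}) = 0 := by
    rw [← map_ofNat f 3]
    exact (hf 3).2 dvd_rfl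
  have h3p : (3 : ZMod p) ≠ 0 := by
    intro h
    have : ((3 : ℕ) : ZMod p) = 0 := by exact_mod_cast h
    rw [ZMod.natCast_eq_zero_iff, Nat.prime_dvd_prime_iff_eq hp Nat.prime_three] at this
    subst this; simp at hp1
  have hχ3 : χ 3 ≠ 1 := fun h ↦ by
    obtain ⟨t, ht⟩ := MulChar.exists_pow_three_eq hχ hχ1 h
    exact hcube ⟨t.val, by simpa using ht⟩
  have hfrob := map_gaussPeriod_pow_three hQ3 f hχ h3p ψ
  have hdiff : 3 ∣ x - y ∧ 3 ∣ y - z := by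
    rw [← hf, map_mul, map_mul, map_sub, map_sub, map_sub] at hD'
    simp only [← hf, map_sub]
    rcases hω.eq_of_pow_three_eq_one (MulChar.apply_pow_three hχ h3p) with h | h | h
    · exact absurd h hχ3
    · rw [h] at hfrob
      have e1 := hfrob 1
      have e2 := hfrob ω
      have e3 := hfrob (ω ^ 2)
      rw [mul_one] at e1
      rw [← sq] at e2
      rw [← pow_succ', h3] at e3
      exact eq_zero_of_artinSchreier_differences hQ3 e1 e2 e3 hD'
    · rw [h] at hfrob
      have e1 := hfrob 1
      have e2 := hfrob ω
      have e3 := hfrob (ω ^ 2)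
      rw [mul_one] at e1
      rw [← pow_succ, h3] at e2
      rw [show ω ^ 2 * ω ^ 2 = ω by linear_combination ω * h3] at e3
      obtain ⟨h1, h2⟩ := eq_zero_of_artinSchreier_differences hQ3 e1 e3 e2
        (by linear_combination -hD')
      exact ⟨by linear_combination h1 + h2, by linear_combination -h2⟩
  obtain ⟨⟨r, hr⟩, ⟨s, hs'⟩⟩ := hdiff
  apply hp3
  apply hdvd 3 p (by norm_num)
  refine ⟨3 * (r + s + ω * s) * (r + s + ω ^ 2 * s), ?_⟩
  push_cast
  have hX : x - z = 3 * (r + s) := by linear_combination hr + hs'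
  rw [← hgg, hg, hg', hX, hs']
  ring

section Eisenstein

open NumberField

theorem exists_cubic_form_of_norm_eq_cube {u v b : ℤ} (huv : IsCoprime u v) (hv : 3 ∣ v)
    (h : u ^ 2 - u * v + v ^ 2 = b ^ 3) :
    ∃ r s : ℤ, u = r ^ 3 + s ^ 3 - 3 * r * s ^ 2 ∧ v = 3 * r * s * (r - s) := by
  have hu : ¬ 3 ∣ u := fun hu ↦ by
    have := huv.isUnit_of_dvd' hu hv
    rw [Int.isUnit_iff] at this
    omega
  have hb : ¬ 3 ∣ b := fun hb ↦ hu <| by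
    have : (3 : ℤ) ∣ u ^ 2 := by
      rw [show u ^ 2 = b ^ 3 + v * (u - v) by linear_combination h]
      exact dvd_add (dvd_pow hb three_ne_zero) (hv.mul_right _)
    exact Int.prime_three.dvd_of_dvd_pow this
  let K := CyclotomicField 3 ℚ
  have : IsCyclotomicExtension {3} ℚ K := CyclotomicField.isCyclotomicExtension 3 ℚ
  have : NumberField K := IsCyclotomicExtension.numberField {3} ℚ K
  have hζ : IsPrimitiveRoot (IsCyclotomicExtension.zeta 3 ℚ K) 3 :=
    IsCyclotomicExtension.zeta_spec 3 ℚ K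
  have : IsPrincipalIdealRing (𝓞 K) := IsCyclotomicExtension.Rat.three_pid K
  set η : 𝓞 K := hζ.toInteger with hη
  have hη3 : η ^ 3 = 1 := hζ.toInteger_cube_eq_one
  have hs : η ^ 2 + η + 1 = 0 := hζ.toInteger_isPrimitiveRoot.sq_add_self_add_one
  have hbasis (z : 𝓞 K) : ∃ r s : ℤ, z = r + s * η := by
    obtain ⟨f, hf, rfl⟩ := hζ.integralPowerBasis.exists_eq_aeval z
    rw [hζ.integralPowerBasis_dim] at hf
    have h1 : f.natDegree ≤ 1 := by
      have : Nat.totient 3 = 2 := by decide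
      omega
    obtain ⟨s, r, rfl⟩ := Polynomial.exists_eq_X_add_C_of_natDegree_le_one h1
    refine ⟨r, s, ?_⟩
    simp [hη, add_comm]
  have hind {a a' c c' : ℤ} (e : (a + c * η : 𝓞 K) = a' + c' * η) : a = a' ∧ c = c' := by
    have e0 : (a - a') ^ 2 - (a - a') * (c - c') + (c - c') ^ 2 = 0 := by
      have : (((a - a') ^ 2 - (a - a') * (c - c') + (c - c') ^ 2 : ℤ) : 𝓞 K) = 0 := by
        push_cast
        linear_combination (a - a' + (c - c') * η ^ 2) * e - (a - a') * (c - c') * hs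
          - (c - c') ^ 2 * hη3
      exact_mod_cast this
    have hc : c - c' = 0 := by nlinarith [sq_nonneg (2 * (a - a') - (c - c'))]
    rw [hc] at e0
    have ha : a - a' = 0 := by nlinarith
    exact ⟨by linarith, by linarith⟩
  have hprod : (u + v * η : 𝓞 K) * (u + v * η ^ 2) = (b : 𝓞 K) ^ 3 := by
    have : ((u ^ 2 - u * v + v ^ 2 : ℤ) : 𝓞 K) = ((b ^ 3 : ℤ) : 𝓞 K) := by rw [h]
    push_cast at this
    linear_combination this + u * v * hs + v ^ 2 * hη3
  have hcop : IsCoprime (u + v * η : 𝓞 K) (u + v * η ^ 2) := by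
    have h3b : IsCoprime (3 : ℤ) (b ^ 3) :=
      ((Int.prime_three.coprime_iff_not_dvd).2 hb).pow_right
    obtain ⟨s, t, hst⟩ := h3b
    obtain ⟨x, y, hxy⟩ := huv
    have hst' : (s * 3 + t * b ^ 3 : 𝓞 K) = 1 := by
      exact_mod_cast congrArg (Int.cast (R := 𝓞 K)) hst
    have hxy' : (x * u + y * v : 𝓞 K) = 1 := by
      exact_mod_cast congrArg (Int.cast (R := 𝓞 K)) hxy
    refine ⟨s * (-(x * (η ^ 2 - η) * η ^ 2) + y * (η ^ 2 - η)) + t * (u + v * η ^ 2),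
      s * (x * (η ^ 2 - η) * η - y * (η ^ 2 - η)), ?_⟩
    have e1 : (η ^ 2 - η) ^ 2 = -3 := by linear_combination (η - 2) * hη3 + hs
    have e2 : -(x * (η ^ 2 - η) * η ^ 2) * (u + v * η) + x * (η ^ 2 - η) * η * (u + v * η ^ 2)
      = 3 * x * (u : 𝓞 K) := by linear_combination -x * u * e1
    have e3 : (y * (η ^ 2 - η)) * (u + v * η) - y * (η ^ 2 - η) * (u + v * η ^ 2)
      = 3 * y * (v : 𝓞 K) := by linear_combination -y * v * e1
    linear_combination hst' + s * e2 + s * e3 + 3 * s * hxy' + t * hprod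
  obtain ⟨z, w, hw⟩ := exists_associated_pow_of_mul_eq_pow' hcop hprod
  obtain ⟨r, s, rfl⟩ := hbasis z
  have hcube : (r + s * η : 𝓞 K) ^ 3
      = (r ^ 3 + s ^ 3 - 3 * r * s ^ 2) + (3 * r * s * (r - s)) * η := by
    linear_combination s ^ 3 * hη3 + 3 * r * s ^ 2 * hs
  rw [hcube] at hw
  set A : ℤ := r ^ 3 + s ^ 3 - 3 * r * s ^ 2 with hA
  set B : ℤ := 3 * r * s * (r - s) with hB
  have hw' : (A + B * η : 𝓞 K) * w = u + v * η := by rw [← hw, hA, hB]; push_cast; rfl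
  have h3B : 3 ∣ B := ⟨r * s * (r - s), by rw [hB]; ring⟩
  have hmem := IsCyclotomicExtension.Rat.Three.Units.mem hζ w
  have hcoe : ((hζ.toInteger_isPrimitiveRoot.isUnit (by decide)).unit : 𝓞 K) = η := rfl
  simp only [List.mem_cons, List.not_mem_nil, or_false] at hmem
  have key (x y : ℤ) (e : (A + B * η : 𝓞 K) * w = x + y * η) : u = x ∧ v = y :=
    hind (hw'.symm.trans e)
  rcases hmem with rfl | rfl | rfl | rfl | rfl | rfl
  · exact ⟨r, s, key A B (by simp)⟩
  · obtain ⟨h1, h2⟩ := key (-A) (-B) (by simp; ring)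
    exact ⟨-r, -s, by rw [h1, hA]; ring, by rw [h2, hB]; ring⟩
  · obtain ⟨h1, h2⟩ := key (-B) (A - B) (by rw [hcoe]; push_cast; linear_combination B * hs)
    omega
  · obtain ⟨h1, h2⟩ := key B (B - A) (by
      rw [Units.val_neg, hcoe]; push_cast; linear_combination -B * hs)
    omega
  · obtain ⟨h1, h2⟩ := key (B - A) (-A) (by
      rw [Units.val_pow_eq_pow_val, hcoe]; push_cast; linear_combination A * hs + B * hη3)
    omega
  · obtain ⟨h1, h2⟩ := key (A - B) A (by
      rw [Units.val_neg, Units.val_pow_eq_pow_val, hcoe]; push_cast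
      linear_combination -A * hs - B * hη3)
    omega

end Eisenstein

section NormForm

variable {p c d u v k : ℤ}

theorem dvd_mul_sub_or_of_dvd_norm (hp : Prime p) (hcd : c ^ 2 - c * d + d ^ 2 = p)
    (h : p ∣ u ^ 2 - u * v + v ^ 2) :
    p ∣ v * c - u * d ∨ p ∣ v * (c - d) - u * (-d) := by
  refine hp.dvd_or_dvd ?_
  rw [show (v * c - u * d) * (v * (c - d) - u * (-d))
    = v ^ 2 * p - d ^ 2 * (u ^ 2 - u * v + v ^ 2) by rw [← hcd]; ring]
  exact dvd_sub (Dvd.intro_left _ rfl) (h.mul_left _)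

theorem exists_factor_of_dvd_mul_sub (hp : Prime p) (hcd : c ^ 2 - c * d + d ^ 2 = p)
    (h : u ^ 2 - u * v + v ^ 2 = p * k) (hdvd : p ∣ v * c - u * d) :
    ∃ u' v' : ℤ, u = c * u' - d * v' ∧ v = c * v' + d * u' - d * v' ∧
      u' ^ 2 - u' * v' + v' ^ 2 = k := by
  obtain ⟨y, hy⟩ := hdvd
  have hx : p ∣ u * (c - d) + v * d := by
    refine hp.dvd_of_dvd_pow (n := 2)
      ⟨p * k + (u * (c - d) + v * d) * y - p * y ^ 2, ?_⟩
    linear_combination p * h + (u ^ 2 - u * v + v ^ 2) * hcd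
      + ((u * (c - d) + v * d) - (v * c - u * d) - p * y) * hy
  obtain ⟨x, hx⟩ := hx
  have hu : u = c * x - d * y := mul_left_cancel₀ hp.ne_zero (by
    linear_combination -u * hcd + c * hx - d * hy)
  have hv : v = c * y + d * x - d * y := mul_left_cancel₀ hp.ne_zero (by
    linear_combination -v * hcd + d * hx + (c - d) * hy)
  refine ⟨x, y, hu, hv, mul_left_cancel₀ hp.ne_zero ?_⟩
  rw [← h, hu, hv, ← hcd]
  ring

theorem exists_sq_factor_of_norm_eq (hp : Prime p) (hcd : c ^ 2 - c * d + d ^ 2 = p)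
    (huv : IsCoprime u v) (h : u ^ 2 - u * v + v ^ 2 = p ^ 2 * k) (hdvd : p ∣ v * c - u * d) :
    ∃ u' v' : ℤ, u = (c ^ 2 - d ^ 2) * u' - (2 * c * d - d ^ 2) * v' ∧
      v = (c ^ 2 - d ^ 2) * v' + (2 * c * d - d ^ 2) * u' - (2 * c * d - d ^ 2) * v' ∧
      u' ^ 2 - u' * v' + v' ^ 2 = k := by
  obtain ⟨x, y, rfl, rfl, hxy⟩ := exists_factor_of_dvd_mul_sub (k := p * k) hp hcd
    (by rw [h]; ring) hdvd
  rcases dvd_mul_sub_or_of_dvd_norm hp hcd (u := x) (v := y) ⟨k, hxy⟩ with h1 | h1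
  · obtain ⟨u', v', rfl, rfl, hk⟩ := exists_factor_of_dvd_mul_sub hp hcd hxy h1
    exact ⟨u', v', by ring, by ring, hk⟩
  · obtain ⟨u', v', rfl, rfl, -⟩ := exists_factor_of_dvd_mul_sub hp
      (by rw [← hcd]; ring) hxy h1
    exact absurd (huv.isUnit_of_dvd' (x := p) ⟨u', by rw [← hcd]; ring⟩
      ⟨v', by rw [← hcd]; ring⟩) hp.not_isUnit

theorem not_nine_dvd_of_norm_eq_sq_mul_cube {b : ℤ} (hp : Prime p)
    (hcd : c ^ 2 - c * d + d ^ 2 = p) (hd : 3 ∣ d) (hd9 : ¬ 9 ∣ d) (huv : IsCoprime u v)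
    (h : u ^ 2 - u * v + v ^ 2 = p ^ 2 * b ^ 3) (hdvd : p ∣ v * c - u * d) : ¬ 9 ∣ v := by
  intro hv
  obtain ⟨x, y, hu', hv', hb⟩ := exists_sq_factor_of_norm_eq hp hcd huv h hdvd
  obtain ⟨e, rfl⟩ := hd
  have hxy : IsCoprime x y := by
    obtain ⟨s, t, hst⟩ := huv
    rw [hu', hv'] at hst
    exact ⟨s * (c ^ 2 - (3 * e) ^ 2) + t * (2 * c * (3 * e) - (3 * e) ^ 2),
      -s * (2 * c * (3 * e) - (3 * e) ^ 2)
        + t * (c ^ 2 - (3 * e) ^ 2 - (2 * c * (3 * e) - (3 * e) ^ 2)),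
      by rw [← hst]; ring⟩
  have he : ¬ 3 ∣ e := by omega
  have hc : ¬ 3 ∣ c := by
    rintro ⟨c', rfl⟩
    rcases hp.irreducible.isUnit_or_isUnit (Eq.symm (by
      rw [← hcd]; ring : 3 * (3 * (c' ^ 2 - c' * e + e ^ 2)) = p)) with h | h <;>
    rw [Int.isUnit_iff] at h <;> omega
  have hy : 3 ∣ y := by
    have : (3 : ℤ) ∣ c ^ 2 * y := by
      obtain ⟨v', rfl⟩ := hv
      exact ⟨3 * v' + 3 * e ^ 2 * y - (2 * c * e - 3 * e ^ 2) * x + (2 * c * e - 3 * e ^ 2) * y,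
        by linear_combination -hv'⟩
    exact (Int.prime_three.dvd_or_dvd this).resolve_left fun h ↦
      hc (Int.prime_three.dvd_of_dvd_pow h)
  have hx : ¬ 3 ∣ x := fun hx ↦ by
    have := hxy.isUnit_of_dvd' hx hy
    rw [Int.isUnit_iff] at this
    omega
  obtain ⟨r, s, hr, hs⟩ := exists_cubic_form_of_norm_eq_cube hxy hy hb
  have hy9 : 9 ∣ y := by
    have h3 : (3 : ℤ) ∣ r * s * (r - s) := by
      by_contra h3
      apply hx
      rw [hr]
      have h1 : ¬ 3 ∣ r := fun h ↦ h3 ((h.mul_right _).mul_right _)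
      have h2 : ¬ 3 ∣ s := fun h ↦ h3 ((h.mul_left _).mul_right _)
      have h4 : ¬ 3 ∣ r - s := fun h ↦ h3 (h.mul_left _)
      have h5 : r % 3 = 1 ∨ r % 3 = 2 := by omega
      have h6 : s % 3 = 1 ∨ s % 3 = 2 := by omega
      obtain ⟨t, ht⟩ : (3 : ℤ) ∣ r + s := by
        rcases h5 with h5 | h5 <;> rcases h6 with h6 | h6 <;> omega
      obtain rfl : r = 3 * t - s := by linarith
      exact ⟨9 * t ^ 3 - 9 * t ^ 2 * s + 3 * t * s ^ 2 - (3 * t - s) * s ^ 2, by ring⟩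
    obtain ⟨t, ht⟩ := h3
    exact ⟨t, by rw [hs]; linear_combination 3 * ht⟩
  obtain ⟨y', rfl⟩ := hy9
  obtain ⟨v', rfl⟩ := hv
  have h3 : (3 : ℤ) ∣ 2 * (c * (e * x)) :=
    ⟨v' - (c ^ 2 - (3 * e) ^ 2) * y' + e ^ 2 * x + (2 * c * (3 * e) - (3 * e) ^ 2) * y', 
      mul_left_cancel₀ three_ne_zero (by linear_combination -hv')⟩
  rcases Int.prime_three.dvd_or_dvd h3 with h | h
  · omega
  · rcases Int.prime_three.dvd_or_dvd h with h | h
    · exact hc h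
    · exact (Int.prime_three.dvd_or_dvd h).elim he hx

end NormForm

section Descent

variable {p : ℕ}

theorem exists_pow_three_zmod_eq_three (hp : p.Prime) {a b c : ℤ}
    (h : 3 * a ^ 3 + p * b + c ^ 3 = 0) (ha : ¬ (p : ℤ) ∣ a) :
    ∃ x : ℤ, (x : ZMod p) ^ 3 = 3 := by
  have : Fact p.Prime := ⟨hp⟩
  have ha' : (a : ZMod p) ≠ 0 := fun h0 ↦ ha ((ZMod.intCast_zmod_eq_zero_iff_dvd a p).1 h0)
  refine ⟨((-c * (a : ZMod p)⁻¹ : ZMod p).val : ℤ), ?_⟩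
  have h' : (3 * a ^ 3 + c ^ 3 : ZMod p) = 0 := by
    have := congrArg (Int.cast (R := ZMod p)) h
    push_cast at this
    simpa using this
  rw [Int.cast_natCast, ZMod.natCast_zmod_val]
  field_simp
  linear_combination -h'

theorem exists_cube_sum_of_three_dvd (hp : p.Prime)
    (hcube : ¬ ∃ x : ℤ, (x : ZMod p) ^ 3 = 3) {X Y Z a : ℤ} (hXY : IsCoprime X Y)
    (hsum : X + Y + Z = 0) (hprod : X * Y * Z = 3 * p ^ 2 * a ^ 3) (h3 : 3 ∣ X) :
    ∃ x y z : ℤ, x ^ 3 + y ^ 3 = 3 * p ^ 2 * z ^ 3 ∧ z ∣ a := by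
  have hpp : Prime (p : ℤ) := Nat.prime_iff_prime_int.1 hp
  have odd3 : Odd 3 := by decide
  obtain ⟨W, rfl⟩ := h3
  have hWY : IsCoprime W Y := hXY.of_mul_left_right
  have hYZ : IsCoprime Y Z := by
    obtain rfl : Z = -(3 * W) + Y * (-1) := by linarith
    exact (hXY.symm.neg_right).add_mul_left_right _
  have hWZ : IsCoprime W Z := by
    obtain rfl : Z = -Y + W * (-3) := by linarith
    exact (hWY.neg_right).add_mul_left_right _
  have hprod' : W * (Y * Z) = p ^ 2 * a ^ 3 := by linarith
  have not_dvd {Y Z : ℤ} (hWY : IsCoprime W Y) (hYZ : IsCoprime Y Z) (hWZ : IsCoprime W Z)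
      (hsum : 3 * W + Y + Z = 0) (hprod : W * (Y * Z) = p ^ 2 * a ^ 3) : ¬ (p : ℤ) ∣ Y := by
    intro hY
    have hc : IsCoprime ((p : ℤ) ^ 2) (W * Z) := by
      refine IsCoprime.pow_left ((hpp.coprime_iff_not_dvd).2 fun h ↦ ?_)
      exact hpp.not_isUnit ((hWY.symm.mul_right hYZ).isUnit_of_dvd' hY h)
    obtain ⟨V, rfl⟩ : (p : ℤ) ^ 2 ∣ Y :=
      hc.dvd_of_dvd_mul_right ⟨a ^ 3, by linear_combination hprod⟩
    have e : W * (V * Z) = a ^ 3 :=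
      mul_left_cancel₀ (pow_ne_zero 2 hpp.ne_zero) (by linear_combination hprod)
    have hWV : IsCoprime W V := hWY.of_mul_right_right
    have hVZ : IsCoprime V Z := hYZ.of_mul_left_right
    obtain ⟨A, rfl⟩ := Int.eq_pow_of_mul_eq_pow_odd_left (hWV.mul_right hWZ) odd3 e
    obtain ⟨C, rfl⟩ := Int.eq_pow_of_mul_eq_pow_odd_left (a := Z) (b := A ^ 3 * V)
      (hWZ.symm.mul_right hVZ.symm) odd3 (by rw [← e]; ring)
    refine hcube (exists_pow_three_zmod_eq_three hp (a := A) (b := p * V) (c := C)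
      (by linear_combination hsum) fun h ↦ ?_)
    exact hpp.not_isUnit (hWY.isUnit_of_dvd' (dvd_pow h three_ne_zero) hY)
  have hY := not_dvd hWY hYZ hWZ hsum hprod'
  have hZ := not_dvd hWZ hYZ.symm hWY (by linarith) (by linarith)
  have hc : IsCoprime ((p : ℤ) ^ 2) (Y * Z) :=
    (((hpp.coprime_iff_not_dvd).2 hY).mul_right ((hpp.coprime_iff_not_dvd).2 hZ)).pow_left
  obtain ⟨V, rfl⟩ : (p : ℤ) ^ 2 ∣ W := hc.dvd_of_dvd_mul_right ⟨a ^ 3, hprod'⟩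
  have e : V * (Y * Z) = a ^ 3 :=
    mul_left_cancel₀ (pow_ne_zero 2 hpp.ne_zero) (by linear_combination hprod')
  have hVY : IsCoprime V Y := hWY.of_mul_left_right
  have hVZ : IsCoprime V Z := hWZ.of_mul_left_right
  obtain ⟨A, rfl⟩ := Int.eq_pow_of_mul_eq_pow_odd_left (hVY.mul_right hVZ) odd3 e
  obtain ⟨B, rfl⟩ := Int.eq_pow_of_mul_eq_pow_odd_left (a := Y) (b := A ^ 3 * Z)
    (hVY.symm.mul_right hYZ) odd3 (by rw [← e]; ring)
  obtain ⟨C, rfl⟩ := Int.eq_pow_of_mul_eq_pow_odd_left (a := Z) (b := A ^ 3 * B ^ 3)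
    (hVZ.symm.mul_right hYZ.symm) odd3 (by rw [← e]; ring)
  refine ⟨B, C, -A, by linear_combination hsum, ?_⟩
  rw [neg_dvd, ← Int.pow_dvd_pow_iff three_ne_zero]
  exact ⟨_, e.symm⟩

theorem exists_cube_sum_of_mul_eq (hp : p.Prime)
    (hcube : ¬ ∃ x : ℤ, (x : ZMod p) ^ 3 = 3) {r s a : ℤ} (hrs : IsCoprime r s)
    (h : r * s * (r - s) = 3 * p ^ 2 * a ^ 3) :
    ∃ x y z : ℤ, x ^ 3 + y ^ 3 = 3 * p ^ 2 * z ^ 3 ∧ z ∣ a := by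
  have h3 : (3 : ℤ) ∣ r * s * (r - s) := ⟨p ^ 2 * a ^ 3, by rw [h]; ring⟩
  rcases Int.prime_three.dvd_or_dvd h3 with h3 | h3
  · rcases Int.prime_three.dvd_or_dvd h3 with h3 | h3
    · exact exists_cube_sum_of_three_dvd hp hcube (X := r) (Y := -s) (Z := s - r)
        hrs.neg_right (by ring) (by linear_combination h) h3
    · exact exists_cube_sum_of_three_dvd hp hcube (X := -s) (Y := r) (Z := s - r)
        hrs.symm.neg_left (by ring) (by linear_combination h) (by simpa using h3)
  · refine exists_cube_sum_of_three_dvd hp hcube (X := s - r) (Y := r) (Z := -s)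
        ?_ (by ring) (by linear_combination h) (by omega)
    rw [show s - r = s + r * (-1) by ring]
    exact hrs.symm.add_mul_left_left _

theorem dvd_of_prime_dvd_of_cube_sum (hp : p.Prime) (hp3 : p ≠ 3) {q : ℕ} (hq : q.Prime)
    {x y z : ℤ} (hx : (q : ℤ) ∣ x) (hy : (q : ℤ) ∣ y)
    (h : x ^ 3 + y ^ 3 = 3 * p ^ 2 * z ^ 3) : (q : ℤ) ∣ z := by
  have hqq : Prime (q : ℤ) := Nat.prime_iff_prime_int.1 hq
  by_contra hz
  have hc : IsCoprime ((q : ℤ) ^ 3) (z ^ 3) := ((hqq.coprime_iff_not_dvd).2 hz).pow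
  have hd : (q : ℤ) ^ 3 ∣ 3 * p ^ 2 :=
    hc.dvd_of_dvd_mul_right (h ▸ dvd_add (pow_dvd_pow_of_dvd hx 3) (pow_dvd_pow_of_dvd hy 3))
  have hd' : q ^ 3 ∣ 3 * p ^ 2 := by exact_mod_cast hd
  rcases (Nat.Prime.dvd_mul hq).1 ((dvd_pow_self q three_ne_zero).trans hd') with h1 | h1
  · rw [Nat.prime_dvd_prime_iff_eq hq Nat.prime_three] at h1
    subst h1
    have : 3 ∣ p ^ 2 := by
      rw [pow_succ', mul_dvd_mul_iff_left (by norm_num)] at hd'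
      exact (dvd_pow_self 3 two_ne_zero).trans hd'
    exact hp3 ((Nat.prime_dvd_prime_iff_eq Nat.prime_three hp).1
      (Nat.prime_three.dvd_of_dvd_pow this)).symm
  · obtain rfl := (Nat.prime_dvd_prime_iff_eq hq hp).1 (hq.dvd_of_dvd_pow h1)
    rw [pow_succ', mul_dvd_mul_iff_right (pow_ne_zero 2 hq.ne_zero)] at hd'
    exact hp3 ((Nat.prime_dvd_prime_iff_eq hq Nat.prime_three).1 hd')

theorem exists_smaller_cube_sum (hp : p.Prime) (hp1 : p % 3 = 1)
    (hcube : ¬ ∃ x : ℤ, (x : ZMod p) ^ 3 = 3) {x y z : ℤ} (hxy : IsCoprime x y)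
    (h : x ^ 3 + y ^ 3 = 3 * p ^ 2 * z ^ 3) :
    ∃ x' y' z' : ℤ, x' ^ 3 + y' ^ 3 = 3 * p ^ 2 * z' ^ 3 ∧ 3 * z' ∣ z := by
  have hpp : Prime (p : ℤ) := Nat.prime_iff_prime_int.1 hp
  have hp3 : p ≠ 3 := by rintro rfl; simp at hp1
  have h3p : ¬ (3 : ℤ) ∣ p := by omega
  have odd3 : Odd 3 := by decide
  obtain ⟨m, hm⟩ : 3 ∣ x + y := Int.prime_three.dvd_of_dvd_pow (n := 3)
    ⟨p ^ 2 * z ^ 3 + x * y * (x + y), by linear_combination h⟩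
  obtain rfl : x = 3 * m - y := by linarith
  obtain ⟨w, rfl⟩ : 3 ∣ z := by
    have : (3 : ℤ) ∣ p ^ 2 * z ^ 3 :=
      ⟨m * (3 * m ^ 2 - 3 * m * y + y ^ 2),
        mul_left_cancel₀ three_ne_zero (by linear_combination -h)⟩
    exact Int.prime_three.dvd_of_dvd_pow
      ((Int.prime_three.dvd_or_dvd this).resolve_left
        fun h ↦ h3p (Int.prime_three.dvd_of_dvd_pow h))
  have hmy : IsCoprime m y := by
    have : IsCoprime (3 * m) y := by
      have := hxy.add_mul_left_left 1
      rwa [mul_one, sub_add_cancel] at this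
    exact this.of_mul_left_right
  have hy3 : ¬ 3 ∣ y := fun hy ↦ by
    have := hxy.isUnit_of_dvd' (x := 3) (by omega) hy
    rw [Int.isUnit_iff] at this
    omega
  set Q := 3 * m ^ 2 - 3 * m * y + y ^ 2 with hQ
  have hmQ : IsCoprime m Q := by
    rw [show Q = y ^ 2 + m * (3 * m - 3 * y) by rw [hQ]; ring]
    exact (hmy.pow_right).add_mul_left_right _
  have h9Q : IsCoprime 9 Q := by
    have : IsCoprime 3 Q := by
      rw [show Q = y ^ 2 + 3 * (m ^ 2 - m * y) by rw [hQ]; ring]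
      exact (((Int.prime_three.coprime_iff_not_dvd).2 hy3).pow_right).add_mul_left_right _
    exact this.pow_left (m := 2)
  have hprod : m * Q = 9 * p ^ 2 * w ^ 3 := 
    mul_left_cancel₀ (show (9 : ℤ) ≠ 0 by norm_num) (by rw [hQ]; linear_combination h)
  obtain ⟨n, rfl⟩ : 9 ∣ m := h9Q.dvd_of_dvd_mul_right ⟨p ^ 2 * w ^ 3, by rw [hprod]; ring⟩
  have hnQ : IsCoprime n Q := hmQ.of_mul_left_right
  have hprod' : n * Q = p ^ 2 * w ^ 3 := by linarith
  have huv : IsCoprime (2 * (9 * n) - y) (9 * n) := by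
    rw [show 2 * (9 * n) - y = -y + 9 * n * 2 by ring]
    exact (hmy.symm.neg_left).add_mul_left_left _
  have hnorm : (2 * (9 * n) - y) ^ 2 - (2 * (9 * n) - y) * (9 * n) + (9 * n) ^ 2 = Q := by
    rw [hQ]; ring
  by_cases hpQ : (p : ℤ) ∣ Q
  · exfalso
    have hc : IsCoprime ((p : ℤ) ^ 2) n := by
      refine IsCoprime.pow_left ((hpp.coprime_iff_not_dvd).2 fun h ↦ ?_)
      exact hpp.not_isUnit (hnQ.isUnit_of_dvd' h hpQ)
    obtain ⟨V, hV⟩ : (p : ℤ) ^ 2 ∣ Q := hc.dvd_of_dvd_mul_left ⟨w ^ 3, hprod'⟩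
    have e : V * n = w ^ 3 :=
      mul_left_cancel₀ (pow_ne_zero 2 hpp.ne_zero) (by rw [← hprod', hV]; ring)
    rw [hV] at hnQ
    obtain ⟨b, rfl⟩ := Int.eq_pow_of_mul_eq_pow_odd_left hnQ.of_mul_right_right.symm odd3 e
    obtain ⟨c, d, hcd, hd3, hd9⟩ := exists_norm_form_of_not_cube hp hp1 hcube
    rw [hV] at hnorm
    rcases dvd_mul_sub_or_of_dvd_norm hpp hcd (hnorm ▸ hV ▸ hpQ) with h1 | h1
    · exact not_nine_dvd_of_norm_eq_sq_mul_cube hpp hcd hd3 hd9 huv hnorm h1 (Dvd.intro _ rfl)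
    · exact not_nine_dvd_of_norm_eq_sq_mul_cube hpp (by rw [← hcd]; ring) (by omega) (by omega)
        huv hnorm h1 (Dvd.intro _ rfl)
  · have hc : IsCoprime ((p : ℤ) ^ 2) Q := ((hpp.coprime_iff_not_dvd).2 hpQ).pow_left
    obtain ⟨V, rfl⟩ : (p : ℤ) ^ 2 ∣ n := hc.dvd_of_dvd_mul_right ⟨w ^ 3, hprod'⟩
    have e : V * Q = w ^ 3 :=
      mul_left_cancel₀ (pow_ne_zero 2 hpp.ne_zero) (by rw [← hprod']; ring)
    have hVQ : IsCoprime V Q := hnQ.of_mul_left_right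
    obtain ⟨a, rfl⟩ := Int.eq_pow_of_mul_eq_pow_odd_left hVQ odd3 e
    obtain ⟨b, hb⟩ := Int.eq_pow_of_mul_eq_pow_odd_left hVQ.symm odd3 (by rw [← e]; ring)
    obtain ⟨r, s, hr, hs⟩ := exists_cubic_form_of_norm_eq_cube huv (by omega) (hnorm.trans hb)
    have hrs : IsCoprime r s := by
      obtain ⟨i, j, hij⟩ := huv
      rw [hr, hs] at hij
      exact ⟨i * r ^ 2 + j * (3 * s * (r - s)), i * (s ^ 2 - 3 * r * s), by rw [← hij]; ring⟩
    obtain ⟨x', y', z', h', hz'⟩ := exists_cube_sum_of_mul_eq hp hcube hrs (a := a)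
      (mul_left_cancel₀ three_ne_zero (by linear_combination -hs))
    refine ⟨x', y', z', h', mul_dvd_mul_left 3 (hz'.trans ?_)⟩
    rw [← Int.pow_dvd_pow_iff three_ne_zero]
    exact ⟨_, e.symm⟩

theorem eq_zero_of_cube_sum_eq (hp : p.Prime) (hp1 : p % 3 = 1)
    (hcube : ¬ ∃ x : ℤ, (x : ZMod p) ^ 3 = 3) {x y z : ℤ}
    (h : x ^ 3 + y ^ 3 = 3 * p ^ 2 * z ^ 3) : z = 0 := by
  have hp3 : p ≠ 3 := by rintro rfl; simp at hp1
  induction hn : z.natAbs using Nat.strong_induction_on generalizing x y z with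
  | _ n ih =>
    subst hn
    by_contra hz
    by_cases hxy : IsCoprime x y
    · obtain ⟨x', y', z', h', k, rfl⟩ := exists_smaller_cube_sum hp hp1 hcube hxy h
      suffices z'.natAbs < (3 * z' * k).natAbs from hz (by rw [ih _ this h' rfl]; ring)
      have hk : k ≠ 0 := by rintro rfl; simp at hz
      have hz' : z' ≠ 0 := by rintro rfl; simp at hz
      rw [Int.natAbs_mul, Int.natAbs_mul, show Int.natAbs 3 = 3 from rfl]
      have := Nat.le_mul_of_pos_right (3 * z'.natAbs) (Int.natAbs_pos.2 hk)
      omega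
    · rw [Int.isCoprime_iff_gcd_eq_one] at hxy
      obtain ⟨q, hq, hqd⟩ := Nat.exists_prime_and_dvd hxy
      have hqx : (q : ℤ) ∣ x := (Int.natCast_dvd_natCast.2 hqd).trans (Int.gcd_dvd_left ..)
      have hqy : (q : ℤ) ∣ y := (Int.natCast_dvd_natCast.2 hqd).trans (Int.gcd_dvd_right ..)
      obtain ⟨z', rfl⟩ := dvd_of_prime_dvd_of_cube_sum hp hp3 hq hqx hqy h
      obtain ⟨x', rfl⟩ := hqx
      obtain ⟨y', rfl⟩ := hqy
      have hq0 : (q : ℤ) ^ 3 ≠ 0 := by exact_mod_cast pow_ne_zero 3 hq.ne_zero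
      suffices hlt : z'.natAbs < (q * z').natAbs from hz (by
        rw [ih _ hlt (x := x') (y := y') (mul_left_cancel₀ hq0 (by linear_combination h)) rfl,
          mul_zero])
      have hz' : z' ≠ 0 := by rintro rfl; simp at hz
      rw [Int.natAbs_mul, Int.natAbs_natCast]
      exact lt_mul_of_one_lt_left (Int.natAbs_pos.2 hz') hq.one_lt

theorem Rat.cube_sum_ne (hp : p.Prime) (hp1 : p % 3 = 1)
    (hcube : ¬ ∃ x : ℤ, (x : ZMod p) ^ 3 = 3) (X Y : ℚ) : X ^ 3 + Y ^ 3 ≠ 3 * p ^ 2 := by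
  intro h
  have hX : (X.den : ℚ) ≠ 0 := by exact_mod_cast X.den_nz
  have hY : (Y.den : ℚ) ≠ 0 := by exact_mod_cast Y.den_nz
  rw [← X.num_div_den, ← Y.num_div_den] at h
  field_simp at h
  have := eq_zero_of_cube_sum_eq hp hp1 hcube (x := X.num * Y.den) (y := Y.num * X.den)
    (z := X.den * Y.den) (by
      have h' : ((X.num * Y.den : ℚ)) ^ 3 + (Y.num * X.den) ^ 3
        = 3 * p ^ 2 * (X.den * Y.den) ^ 3 := by linear_combination h
      exact_mod_cast h')
  simp at this

end Descent

theorem Ecurve_subsingleton_point {p : ℕ} (hp : p.Prime) (hp1 : p % 3 = 1)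
    (hcube : ¬ ∃ x : ℤ, (x : ZMod p) ^ 3 = 3) :
    Subsingleton (Ecurve (3 * (p : ℚ) ^ 2)).Point := by
  suffices h : ∀ P : (Ecurve (3 * (p : ℚ) ^ 2)).Point, P = 0 from
    ⟨fun P Q ↦ (h P).trans (h Q).symm⟩
  rintro (_ | ⟨x, y, h⟩)
  · rfl
  · exfalso
    have he := (WeierstrassCurve.Affine.equation_iff _ _).1 h.1
    simp only [Ecurve] at he
    have hp0 : (p : ℚ) ≠ 0 := by exact_mod_cast hp.ne_zero
    have hx : x ≠ 0 := by
      rintro rfl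
      have : 0 < (p : ℚ) ^ 4 := by positivity
      nlinarith [sq_nonneg y]
    refine Rat.cube_sum_ne hp hp1 hcube
      ((36 * (3 * (p : ℚ) ^ 2) + y) / (6 * x)) ((36 * (3 * (p : ℚ) ^ 2) - y) / (6 * x)) ?_
    field_simp
    linear_combination 648 * p ^ 2 * he

theorem stmt_2 (p : ℕ) (hp : p.Prime) (hmod : p % 9 = 4 ∨ p % 9 = 7)
    (hcube : ¬ ∃ x : ℤ, (x : ZMod p) ^ 3 = 3) :
    Module.finrank ℚ (ℚ ⊗[ℤ] (Ecurve (3 * (p : ℚ) ^ 2)).Point) = 0 ∧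
    ∀ P : (Ecurve (3 * (p : ℚ) ^ 2)).Point, IsOfFinAddOrder P := by
  have := Ecurve_subsingleton_point hp (by omega) hcube
  refine ⟨?_, fun P ↦ ?_⟩
  · have : Subsingleton (ℚ ⊗[ℤ] (Ecurve (3 * (p : ℚ) ^ 2)).Point) :=
      subsingleton_of_forall_eq 0 fun t ↦ by
        induction t with
        | zero => rfl
        | tmul a P => rw [Subsingleton.elim P 0, TensorProduct.tmul_zero]
        | add a b ha hb => rw [ha, hb, add_zero]
    exact Module.finrank_zero_of_subsingleton
  · rw [Subsingleton.elim P 0]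
    exact IsOfFinAddOrder.zero
end

section
/- Let p be a prime number and let ν : ℚ_p^× → ℂ^× be a group homomorphism of conductor c ≥ 2, i.e. ν is trivial on the subgroup 1 + p^c ℤ_p but nontrivial on 1 + p^{c−1} ℤ_p. Let ψ : (ℚ_p, +) → ℂ^× be an additive character that is trivial on ℤ_p and nontrivial on p^{−1}ℤ_p. Then there exists α ∈ ℚ_p^× with p-adic valuation v_p(α) = −c such that ν(1 + u) = ψ(α u) for every u ∈ ℚ_p with v_p(u) ≥ ⌈c/2⌉. Moreover α is unique modulo p^{−⌈c/2⌉}ℤ_p: if α′ has the same property then α − α′ ∈ p^{−⌈c/2⌉}ℤ_p. -/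
/-- Every `p`-adic integer is congruent to a natural number modulo `p ^ n`. -/
theorem exists_nat_norm_sub_le (p : ℕ) [Fact p.Prime] (n : ℕ) (x : ℚ_[p]) (hx : ‖x‖ ≤ 1) :
    ∃ k : ℕ, ‖x - k‖ ≤ (p : ℝ) ^ (-(n : ℤ)) := by
  refine ⟨PadicInt.appr ⟨x, hx⟩ n, ?_⟩
  have h := PadicInt.appr_spec n (⟨x, hx⟩ : ℤ_[p])
  rw [← PadicInt.norm_le_pow_iff_mem_span_pow] at h
  exact h

theorem AddChar.eq_of_norm_sub_le_one {p : ℕ} [Fact p.Prime] {ψ : AddChar ℚ_[p] ℂ}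
    (hψ_triv : ∀ x : ℚ_[p], ‖x‖ ≤ 1 → ψ x = 1) {x y : ℚ_[p]} (h : ‖x - y‖ ≤ 1) :
    ψ x = ψ y := by
  have : x = y + (x - y) := by ring
  rw [this, ψ.map_add_eq_mul, hψ_triv _ h, mul_one]

theorem AddChar.map_natCast_mul_eq_pow {p : ℕ} [Fact p.Prime] (ψ : AddChar ℚ_[p] ℂ)
    (k : ℕ) (x : ℚ_[p]) : ψ (k * x) = ψ x ^ k := by
  rw [← nsmul_eq_mul, ψ.map_nsmul_eq_pow]

theorem AddChar.map_inv_prime_ne_one {p : ℕ} [Fact p.Prime] {ψ : AddChar ℚ_[p] ℂ}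
    (hψ_triv : ∀ x : ℚ_[p], ‖x‖ ≤ 1 → ψ x = 1)
    (hψ_nontriv : ∃ x : ℚ_[p], ‖x‖ ≤ (p : ℝ) ∧ ψ x ≠ 1) : ψ (p : ℚ_[p])⁻¹ ≠ 1 := by
  obtain ⟨x, hx, hne⟩ := hψ_nontriv
  have hp : (0 : ℝ) < p := by exact_mod_cast (Fact.out : p.Prime).pos
  have hp' : (p : ℚ_[p]) ≠ 0 := by exact_mod_cast (Fact.out : p.Prime).ne_zero
  intro h
  apply hne
  obtain ⟨k, hk⟩ := exists_nat_norm_sub_le p 1 (p * x) (by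
    rw [norm_mul, Padic.norm_p, inv_mul_le_iff₀ hp]; simpa using hx)
  have : ‖x - k * (p : ℚ_[p])⁻¹‖ ≤ 1 := by
    have e : x - k * (p : ℚ_[p])⁻¹ = (p : ℚ_[p])⁻¹ * (p * x - k) := by field_simp
    rw [e, norm_mul, norm_inv, Padic.norm_p, inv_inv]
    calc (p : ℝ) * ‖p * x - k‖ ≤ p * (p : ℝ) ^ (-((1 : ℕ) : ℤ)) := by gcongr
      _ = 1 := by simp [hp.ne']
  rw [AddChar.eq_of_norm_sub_le_one hψ_triv this, ψ.map_natCast_mul_eq_pow, h, one_pow]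

theorem AddChar.isPrimitiveRoot_map_inv_pow {p : ℕ} [Fact p.Prime] {ψ : AddChar ℚ_[p] ℂ}
    (hψ_triv : ∀ x : ℚ_[p], ‖x‖ ≤ 1 → ψ x = 1)
    (hψ_nontriv : ∃ x : ℚ_[p], ‖x‖ ≤ (p : ℝ) ∧ ψ x ≠ 1) (n : ℕ) :
    IsPrimitiveRoot (ψ ((p : ℚ_[p]) ^ n)⁻¹) (p ^ n) := by
  have hp' : (p : ℚ_[p]) ≠ 0 := by exact_mod_cast (Fact.out : p.Prime).ne_zero
  cases n with
  | zero => simp [hψ_triv 1 (by simp)]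
  | succ n =>
    rw [← orderOf_eq_prime_pow (p := p) (n := n) (x := ψ ((p : ℚ_[p]) ^ (n + 1))⁻¹)]
    · exact IsPrimitiveRoot.orderOf _
    · rw [← ψ.map_natCast_mul_eq_pow]
      have e : ((p ^ n : ℕ) : ℚ_[p]) * ((p : ℚ_[p]) ^ (n + 1))⁻¹ = (p : ℚ_[p])⁻¹ := by
        push_cast; field_simp; ring
      rw [e]
      exact AddChar.map_inv_prime_ne_one hψ_triv hψ_nontriv
    · rw [← ψ.map_natCast_mul_eq_pow]
      apply hψ_triv
      have e : ((p ^ (n + 1) : ℕ) : ℚ_[p]) * ((p : ℚ_[p]) ^ (n + 1))⁻¹ = 1 := by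
        push_cast; field_simp
      rw [e, norm_one]

/-- A character of `p ^ m ℤ_p` trivial on `p ^ (m + n) ℤ_p` is `u ↦ ψ (a p ^ (-(m + n)) u)` for
some natural number `a`. -/
theorem AddChar.exists_nat_eq_of_additive {p : ℕ} [Fact p.Prime] {ψ : AddChar ℚ_[p] ℂ}
    (hψ_triv : ∀ x : ℚ_[p], ‖x‖ ≤ 1 → ψ x = 1)
    (hψ_nontriv : ∃ x : ℚ_[p], ‖x‖ ≤ (p : ℝ) ∧ ψ x ≠ 1) (m n : ℕ) (f : ℚ_[p] → ℂ)
    (hadd : ∀ u v, ‖u‖ ≤ (p : ℝ) ^ (-(m : ℤ)) → ‖v‖ ≤ (p : ℝ) ^ (-(m : ℤ)) →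
      f (u + v) = f u * f v)
    (htriv : ∀ u, ‖u‖ ≤ (p : ℝ) ^ (-((m + n : ℕ) : ℤ)) → f u = 1) :
    ∃ a : ℕ, ∀ u, ‖u‖ ≤ (p : ℝ) ^ (-(m : ℤ)) →
      f u = ψ (a * ((p : ℚ_[p]) ^ (m + n))⁻¹ * u) := by
  have hp : (0 : ℝ) < p := by exact_mod_cast (Fact.out : p.Prime).pos
  have hp' : (p : ℚ_[p]) ≠ 0 := by exact_mod_cast (Fact.out : p.Prime).ne_zero
  have hp1 : (1 : ℝ) ≤ p := by exact_mod_cast (Fact.out : p.Prime).one_le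
  have hnat : ∀ k : ℕ, ‖(k : ℚ_[p]) * (p : ℚ_[p]) ^ m‖ ≤ (p : ℝ) ^ (-(m : ℤ)) := by
    intro k
    rw [norm_mul, Padic.norm_p_pow]
    exact mul_le_of_le_one_left (by positivity) (IsUltrametricDist.norm_natCast_le_one ℚ_[p] k)
  have hpow : ∀ k : ℕ, f (k * (p : ℚ_[p]) ^ m) = f ((p : ℚ_[p]) ^ m) ^ k := by
    intro k
    induction k with
    | zero => simp [htriv 0 (by rw [norm_zero]; positivity)]
    | succ k ih =>
      rw [Nat.cast_succ, add_mul, one_mul, hadd _ _ (hnat k) (by simp), ih, pow_succ]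
  have hroot : f ((p : ℚ_[p]) ^ m) ^ p ^ n = 1 := by
    rw [← hpow]
    apply htriv
    rw [Nat.cast_pow, ← pow_add, Padic.norm_p_pow, add_comm]
  have : NeZero (p ^ n) := ⟨pow_ne_zero _ (Fact.out : p.Prime).ne_zero⟩
  obtain ⟨a, -, ha⟩ := (AddChar.isPrimitiveRoot_map_inv_pow hψ_triv hψ_nontriv n).eq_pow_of_pow_eq_one
    hroot
  refine ⟨a, fun u hu => ?_⟩
  obtain ⟨k, hk⟩ := exists_nat_norm_sub_le p n (((p : ℚ_[p]) ^ m)⁻¹ * u) (by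
    rw [norm_mul, norm_inv, Padic.norm_p_pow, inv_mul_le_iff₀ (by positivity), mul_one]
    exact hu)
  set r := ((p : ℚ_[p]) ^ m)⁻¹ * u - k with hr
  have hu' : u = k * (p : ℚ_[p]) ^ m + (p : ℚ_[p]) ^ m * r := by
    rw [hr]; field_simp; ring
  have hrn : ‖(p : ℚ_[p]) ^ m * r‖ ≤ (p : ℝ) ^ (-((m + n : ℕ) : ℤ)) := by
    rw [norm_mul, Padic.norm_p_pow, Nat.cast_add, neg_add, zpow_add₀ hp.ne']
    gcongr
  have hrm : ‖(p : ℚ_[p]) ^ m * r‖ ≤ (p : ℝ) ^ (-(m : ℤ)) :=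
    hrn.trans (zpow_le_zpow_right₀ hp1 (by push_cast; lia))
  have hψ : ψ (a * ((p : ℚ_[p]) ^ (m + n))⁻¹ * u) =
      ψ ((k : ℚ_[p]) * (a * ((p : ℚ_[p]) ^ n)⁻¹)) := by
    apply AddChar.eq_of_norm_sub_le_one hψ_triv
    have e : a * ((p : ℚ_[p]) ^ (m + n))⁻¹ * u - (k : ℚ_[p]) * (a * ((p : ℚ_[p]) ^ n)⁻¹) =
        a * (((p : ℚ_[p]) ^ n)⁻¹ * r) := by
      rw [hu', pow_add]; field_simp; ring
    rw [e, norm_mul, norm_mul, norm_inv, Padic.norm_p_pow]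
    refine mul_le_one₀ (IsUltrametricDist.norm_natCast_le_one ℚ_[p] a) (by positivity) ?_
    rwa [inv_mul_le_iff₀ (by positivity), mul_one]
  rw [hψ, ψ.map_natCast_mul_eq_pow, ψ.map_natCast_mul_eq_pow, ha, ← hpow]
  conv_lhs => rw [hu', hadd _ _ (hnat k) hrm, htriv _ hrn, mul_one]


/-- **Lemma on additive expression of a multiplicative character.**
Let `ν : ℚ_p^× → ℂ^×` have conductor `c ≥ 2` (trivial on `1 + p^c ℤ_p`, nontrivial on
`1 + p^(c-1) ℤ_p`), and let `ψ` be an additive character of `ℚ_p` trivial on `ℤ_p` but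
nontrivial on `p⁻¹ ℤ_p`.  Then there is `α` with `v_p(α) = -c` such that
`ν (1 + u) = ψ (α * u)` whenever `v_p(u) ≥ ⌈c/2⌉`, and `α` is unique modulo
`p^(-⌈c/2⌉) ℤ_p`. -/
theorem stmt_3 (p : ℕ) [Fact p.Prime] (c : ℕ) (hc : 2 ≤ c)
    (ν : ℚ_[p]ˣ →* ℂˣ)
    (hν_triv : ∀ w : ℚ_[p]ˣ, ‖(w : ℚ_[p]) - 1‖ ≤ (p : ℝ) ^ (-(c : ℤ)) → ν w = 1)
    (hν_nontriv : ∃ w : ℚ_[p]ˣ, ‖(w : ℚ_[p]) - 1‖ ≤ (p : ℝ) ^ (-(c : ℤ) + 1) ∧ ν w ≠ 1)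
    (ψ : AddChar ℚ_[p] ℂ)
    (hψ_triv : ∀ x : ℚ_[p], ‖x‖ ≤ 1 → ψ x = 1)
    (hψ_nontriv : ∃ x : ℚ_[p], ‖x‖ ≤ (p : ℝ) ∧ ψ x ≠ 1) :
    ∃ α : ℚ_[p], α ≠ 0 ∧ α.valuation = -(c : ℤ) ∧
      (∀ (u : ℚ_[p]) (w : ℚ_[p]ˣ),
        ‖u‖ ≤ (p : ℝ) ^ (-(((c + 1) / 2 : ℕ) : ℤ)) → (w : ℚ_[p]) = 1 + u →
          (ν w : ℂ) = ψ (α * u)) ∧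
      ∀ α' : ℚ_[p], α' ≠ 0 → α'.valuation = -(c : ℤ) →
        (∀ (u : ℚ_[p]) (w : ℚ_[p]ˣ),
          ‖u‖ ≤ (p : ℝ) ^ (-(((c + 1) / 2 : ℕ) : ℤ)) → (w : ℚ_[p]) = 1 + u →
            (ν w : ℂ) = ψ (α' * u)) →
        ‖α - α'‖ ≤ (p : ℝ) ^ ((((c + 1) / 2 : ℕ) : ℤ)) := by
  have hp : (0 : ℝ) < p := by exact_mod_cast (Fact.out : p.Prime).pos
  have hp' : (p : ℚ_[p]) ≠ 0 := by exact_mod_cast (Fact.out : p.Prime).ne_zero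
  have hp1 : (1 : ℝ) < p := by exact_mod_cast (Fact.out : p.Prime).one_lt
  obtain ⟨m, hm⟩ : ∃ m, m = (c + 1) / 2 := ⟨_, rfl⟩
  obtain ⟨n, hn⟩ : ∃ n, c = m + n := ⟨c - m, by lia⟩
  rw [← hm]
  have hlt : ∀ u : ℚ_[p], ‖u‖ ≤ (p : ℝ) ^ (-(m : ℤ)) → ‖u‖ < 1 := fun u hu =>
    hu.trans_lt (zpow_lt_one_of_neg₀ hp1 (by lia))
  have hnorm : ∀ u : ℚ_[p], ‖u‖ ≤ (p : ℝ) ^ (-(m : ℤ)) → ‖1 + u‖ = 1 := by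
    intro u hu
    rw [IsUltrametricDist.norm_add_eq_max_of_norm_ne_norm (by rw [norm_one]; exact (hlt u hu).ne'),
      norm_one, max_eq_left (hlt u hu).le]
  have hne : ∀ u : ℚ_[p], ‖u‖ ≤ (p : ℝ) ^ (-(m : ℤ)) → 1 + u ≠ 0 := by
    intro u hu h
    simpa [h] using hnorm u hu
  classical
  let f : ℚ_[p] → ℂ := fun u => if h : 1 + u = 0 then 1 else (ν (Units.mk0 _ h) : ℂ)
  have hf : ∀ (u : ℚ_[p]) (w : ℚ_[p]ˣ), (w : ℚ_[p]) = 1 + u → f u = ν w := by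
    intro u w h
    have h0 : 1 + u ≠ 0 := h ▸ w.ne_zero
    have : w = Units.mk0 _ h0 := Units.ext h
    simp only [f, dif_neg h0, this]
  have hadd : ∀ u v, ‖u‖ ≤ (p : ℝ) ^ (-(m : ℤ)) → ‖v‖ ≤ (p : ℝ) ^ (-(m : ℤ)) →
      f (u + v) = f u * f v := by
    intro u v hu hv
    have huv : ‖u + v‖ ≤ (p : ℝ) ^ (-(m : ℤ)) :=
      (Padic.nonarchimedean u v).trans (max_le hu hv)
    rw [hf u (Units.mk0 _ (hne u hu)) rfl, hf v (Units.mk0 _ (hne v hv)) rfl,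
      hf _ (Units.mk0 _ (hne _ huv)) rfl, ← Units.val_mul, ← map_mul, Units.val_inj]
    set a := Units.mk0 _ (hne u hu) * Units.mk0 _ (hne v hv) with ha
    set b := Units.mk0 _ (hne _ huv) with hb
    have h1 : ν (a * b⁻¹) = 1 := by
      apply hν_triv
      have e : ((a * b⁻¹ : ℚ_[p]ˣ) : ℚ_[p]) - 1 = u * v / (1 + (u + v)) := by
        have := hne _ huv
        simp only [ha, hb, Units.val_mul, Units.val_inv_eq_inv_val, Units.val_mk0]
        field_simp
        ring
      rw [e, norm_div, norm_mul, hnorm _ huv, div_one]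
      calc ‖u‖ * ‖v‖ ≤ (p : ℝ) ^ (-(m : ℤ)) * (p : ℝ) ^ (-(m : ℤ)) := by gcongr
        _ = (p : ℝ) ^ (-(m : ℤ) + -(m : ℤ)) := (zpow_add₀ hp.ne' _ _).symm
        _ ≤ _ := zpow_le_zpow_right₀ hp1.le (by lia)
    rw [map_mul, map_inv, mul_inv_eq_one] at h1
    exact h1.symm
  have htriv : ∀ u, ‖u‖ ≤ (p : ℝ) ^ (-((m + n : ℕ) : ℤ)) → f u = 1 := by
    intro u hu
    have hu' : ‖u‖ ≤ (p : ℝ) ^ (-(m : ℤ)) := hu.trans (zpow_le_zpow_right₀ hp1.le (by lia))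
    rw [hf u (Units.mk0 _ (hne u hu')) rfl, hν_triv _ (by simpa [hn] using hu), Units.val_one]
  obtain ⟨a, ha⟩ := AddChar.exists_nat_eq_of_additive hψ_triv hψ_nontriv m n f hadd htriv
  rw [← hn] at ha
  have hrep : ∀ (u : ℚ_[p]) (w : ℚ_[p]ˣ), ‖u‖ ≤ (p : ℝ) ^ (-(m : ℤ)) → (w : ℚ_[p]) = 1 + u →
      (ν w : ℂ) = ψ (a * ((p : ℚ_[p]) ^ c)⁻¹ * u) := by
    intro u w hu hw
    rw [← hf u w hw, ha u hu]
  have hanorm : ‖(a : ℚ_[p])‖ = 1 := by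
    refine le_antisymm (IsUltrametricDist.norm_natCast_le_one ℚ_[p] a) (not_lt.mp fun hlt1 => ?_)
    obtain ⟨w, hw, hw1⟩ := hν_nontriv
    have hap : ‖(a : ℚ_[p])‖ ≤ (p : ℝ) ^ (-1 : ℤ) := by
      rw [Padic.norm_le_pow_iff_norm_lt_pow_add_one]
      simpa using hlt1
    apply hw1
    rw [← Units.val_eq_one, hrep (w - 1) w (hw.trans (zpow_le_zpow_right₀ hp1.le (by lia)))
      (by ring)]
    apply hψ_triv
    rw [norm_mul, norm_mul, norm_inv, Padic.norm_p_pow]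
    calc ‖(a : ℚ_[p])‖ * ((p : ℝ) ^ (-(c : ℤ)))⁻¹ * ‖(w : ℚ_[p]) - 1‖
        ≤ (p : ℝ) ^ (-1 : ℤ) * ((p : ℝ) ^ (-(c : ℤ)))⁻¹ * (p : ℝ) ^ (-(c : ℤ) + 1) := by gcongr
      _ = 1 := by
        rw [← zpow_neg, ← zpow_add₀ hp.ne', ← zpow_add₀ hp.ne']
        simp
  have ha0 : (a : ℚ_[p]) ≠ 0 := by
    intro h
    simp [h] at hanorm
  have hα0 : (a : ℚ_[p]) * ((p : ℚ_[p]) ^ c)⁻¹ ≠ 0 := mul_ne_zero ha0 (by positivity)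
  refine ⟨a * ((p : ℚ_[p]) ^ c)⁻¹, hα0, ?_, hrep, ?_⟩
  · have h := Padic.norm_eq_zpow_neg_valuation hα0
    rw [norm_mul, hanorm, norm_inv, Padic.norm_p_pow, one_mul, ← zpow_neg] at h
    have := zpow_right_injective₀ hp hp1.ne' h
    lia
  · intro α' _ _ hα'
    by_contra! hcon
    set β := (a : ℚ_[p]) * ((p : ℚ_[p]) ^ c)⁻¹ - α' with hβ
    have hβ0 : β ≠ 0 := by
      intro h
      rw [h, norm_zero] at hcon
      exact absurd hcon (not_lt.mpr (by positivity))
    have hβn : (p : ℝ) ^ ((m : ℤ) + 1) ≤ ‖β‖ := by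
      by_contra! h
      exact absurd hcon (not_lt.mpr ((Padic.norm_le_pow_iff_norm_lt_pow_add_one _ _).mpr h))
    obtain ⟨x, hx, hxne⟩ := hψ_nontriv
    have hu : ‖x / β‖ ≤ (p : ℝ) ^ (-(m : ℤ)) := by
      rw [norm_div, div_le_iff₀ (norm_pos_iff.mpr hβ0)]
      calc ‖x‖ ≤ p := hx
        _ = (p : ℝ) ^ (-(m : ℤ)) * (p : ℝ) ^ ((m : ℤ) + 1) := by
          rw [← zpow_add₀ hp.ne']; simp
        _ ≤ _ := by gcongr
    have h1 := hrep (x / β) (Units.mk0 _ (hne _ hu)) hu rfl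
    rw [hα' (x / β) (Units.mk0 _ (hne _ hu)) hu rfl] at h1
    have e : a * ((p : ℚ_[p]) ^ c)⁻¹ * (x / β) = α' * (x / β) + x := by
      have : a * ((p : ℚ_[p]) ^ c)⁻¹ = β + α' := by rw [hβ]; ring
      rw [this]; field_simp; ring
    rw [e, ψ.map_add_eq_mul] at h1
    exact hxne (mul_left_cancel₀ (ψ.val_isUnit _).ne_zero (by rw [← h1, mul_one]))
end

section
/- Let σ : R → R be the unique nontrivial ℤ₃-algebra automorphism of R (so σ(ω) = ω²). Then for every unit γ ∈ R^× and every u ∈ R with u³ = 1, the element 1 + u·γ·σ(γ)^{−1} is a unit of R (i.e. it has 3-adic valuation 0). -/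
open Polynomial

/-- `R = ℤ₃[ω] = ℤ₃[X]/(X² + X + 1)`, the ring of integers of `ℚ₃(√-3)`. -/
noncomputable def Zomega : Type := AdjoinRoot (X ^ 2 + X + 1 : Polynomial ℤ_[3])

noncomputable instance : CommRing Zomega := by unfold Zomega; infer_instance

noncomputable instance : Algebra ℤ_[3] Zomega := by unfold Zomega; infer_instance

/-- `ω`, the class of `X` in `R = ℤ₃[X]/(X² + X + 1)`: a primitive cube root of unity. -/
noncomputable def omega3 : Zomega := AdjoinRoot.root (X ^ 2 + X + 1 : Polynomial ℤ_[3])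

lemma omega3_sq_add : omega3 ^ 2 + omega3 + 1 = 0 := by
  have h := AdjoinRoot.eval₂_root (X ^ 2 + X + 1 : Polynomial ℤ_[3])
  simp only [eval₂_add, eval₂_pow, eval₂_X, eval₂_one] at h
  exact h

lemma exists_eq_aeval_omega3 (x : Zomega) : ∃ p : Polynomial ℤ_[3], x = aeval omega3 p := by
  obtain ⟨p, hp⟩ := AdjoinRoot.mk_surjective (g := (X ^ 2 + X + 1 : Polynomial ℤ_[3])) x
  refine ⟨p, hp.symm.trans ?_⟩
  exact (AdjoinRoot.aeval_eq (f := (X ^ 2 + X + 1 : Polynomial ℤ_[3])) p).symm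

lemma isIntegral_omega3 : IsIntegral ℤ_[3] omega3 := by
  refine ⟨X ^ 2 + X + 1, by monicity!, ?_⟩
  simpa only [eval₂_add, eval₂_pow, eval₂_X, eval₂_one] using omega3_sq_add

instance : Algebra.IsIntegral ℤ_[3] Zomega where
  isIntegral x := by
    obtain ⟨p, rfl⟩ := exists_eq_aeval_omega3 x
    exact .of_mem_of_fg _ isIntegral_omega3.fg_adjoin_singleton _ (aeval_mem_adjoin_singleton _ _)

lemma three_mem_of_isMaximal (M : Ideal Zomega) [M.IsMaximal] : (3 : Zomega) ∈ M := by
  have hM : (M.comap (algebraMap ℤ_[3] Zomega)).IsMaximal :=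
    Ideal.isMaximal_comap_of_isIntegral_of_isMaximal M
  have h : (3 : ℤ_[3]) ∈ M.comap (algebraMap ℤ_[3] Zomega) := by
    rw [IsLocalRing.eq_maximalIdeal hM, PadicInt.maximalIdeal_eq_span_p]
    exact Ideal.mem_span_singleton_self _
  rwa [Ideal.mem_comap, map_ofNat] at h

lemma omega3_sub_one_mem_of_isMaximal (M : Ideal Zomega) [M.IsMaximal] : omega3 - 1 ∈ M := by
  refine Ideal.IsPrime.mem_of_pow_mem inferInstance 2 ?_
  have h : (omega3 - 1) ^ 2 = (-omega3) * 3 := by linear_combination omega3_sq_add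
  rw [h]
  exact M.mul_mem_left _ (three_mem_of_isMaximal M)

lemma apply_sub_self_mem_of_isMaximal (σ : Zomega ≃ₐ[ℤ_[3]] Zomega)
    (hσ : σ omega3 = omega3 ^ 2) (M : Ideal Zomega) [M.IsMaximal] (x : Zomega) :
    σ x - x ∈ M := by
  obtain ⟨p, rfl⟩ := exists_eq_aeval_omega3 x
  have hp : σ (aeval omega3 p) = aeval (omega3 ^ 2) p := by rw [← hσ, aeval_algHom_apply σ]
  rw [hp]
  have hdvd := sub_dvd_eval_sub (omega3 ^ 2) omega3 (p.map (algebraMap ℤ_[3] Zomega))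
  simp only [eval_map_algebraMap] at hdvd
  refine M.mem_of_dvd hdvd ?_
  have h : omega3 ^ 2 - omega3 = omega3 * (omega3 - 1) := by ring
  rw [h]
  exact M.mul_mem_left _ (omega3_sub_one_mem_of_isMaximal M)

lemma sub_one_mem_of_pow_three_eq_one (M : Ideal Zomega) [M.IsMaximal] {u : Zomega}
    (hu : u ^ 3 = 1) : u - 1 ∈ M := by
  refine Ideal.IsPrime.mem_of_pow_mem inferInstance 3 ?_
  have h : (u - 1) ^ 3 = (u - u ^ 2) * 3 := by linear_combination hu
  rw [h]
  exact M.mul_mem_left _ (three_mem_of_isMaximal M)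

/-- If `σ` is the nontrivial `ℤ₃`-algebra automorphism of `R` (determined by
`σ ω = ω²`), then for every unit `γ` of `R` and every cube root of unity `u` in `R`,
the element `1 + u · γ · σ(γ)⁻¹` is a unit of `R`. -/
theorem stmt_5 (σ : Zomega ≃ₐ[ℤ_[3]] Zomega) (hσ : σ omega3 = omega3 ^ 2)
    (γ : Zomegaˣ) (u : Zomega) (hu : u ^ 3 = 1) :
    IsUnit (1 + u * (γ : Zomega) * σ ((γ⁻¹ : Zomegaˣ) : Zomega)) := by
  by_contra hnu
  obtain ⟨M, hM, hmem⟩ := exists_max_ideal_of_mem_nonunits hnu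
  refine hM.ne_top ((Ideal.eq_top_iff_one M).2 ?_)
  have hγ : (γ : Zomega) * ((γ⁻¹ : Zomegaˣ) : Zomega) = 1 := γ.mul_inv
  set δ : Zomega := ((γ⁻¹ : Zomegaˣ) : Zomega)
  have h : (1 : Zomega) = 3 + (γ * σ δ) * (u - 1) + γ * (σ δ - δ) - (1 + u * γ * σ δ) := by
    linear_combination hγ
  rw [h]
  exact M.sub_mem (M.add_mem (M.add_mem (three_mem_of_isMaximal M)
    (M.mul_mem_left _ (sub_one_mem_of_pow_three_eq_one M hu)))
    (M.mul_mem_left _ (apply_sub_self_mem_of_isMaximal σ hσ M δ))) hmem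
end

section
/- The quotient of the unit group R^× by the subgroup generated by ℤ₃^× and 1 + 9R is isomorphic to ℤ/3ℤ × ℤ/3ℤ, and it is generated by the classes of ω and of 1 + 3ω. -/
open Polynomial

/-- The subgroup of `R^×` generated by `ℤ₃^×` and `1 + 9R`. -/
noncomputable def H6 : Subgroup Zomegaˣ :=
  Subgroup.closure
    (Set.range (Units.map (algebraMap ℤ_[3] Zomega : ℤ_[3] →* Zomega)) ∪
      {u : Zomegaˣ | ∃ x : Zomega, (u : Zomega) = 1 + 9 * x})

theorem omega3_sq : omega3 ^ 2 = -1 - omega3 := by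
  have h := AdjoinRoot.eval₂_root (X ^ 2 + X + 1 : Polynomial ℤ_[3])
  simp only [eval₂_add, eval₂_pow, eval₂_X, eval₂_one] at h
  have h' : omega3 ^ 2 + omega3 + 1 = 0 := h
  linear_combination h'

/-- The ring homomorphism out of `R` attached to a root of `X² + X + 1`. -/
noncomputable def Zomega.lift {S : Type*} [CommRing S] (f : ℤ_[3] →+* S) (s : S)
    (hs : s ^ 2 + s + 1 = 0) : Zomega →+* S :=
  (AdjoinRoot.lift f s (by simpa [eval₂_add] using hs) :
    AdjoinRoot (X ^ 2 + X + 1 : Polynomial ℤ_[3]) →+* S)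

@[simp]
theorem Zomega.lift_omega3 {S : Type*} [CommRing S] (f : ℤ_[3] →+* S) (s : S)
    (hs : s ^ 2 + s + 1 = 0) : Zomega.lift f s hs omega3 = s :=
  AdjoinRoot.lift_root _

@[simp]
theorem Zomega.lift_algebraMap {S : Type*} [CommRing S] (f : ℤ_[3] →+* S) (s : S)
    (hs : s ^ 2 + s + 1 = 0) (a : ℤ_[3]) :
    Zomega.lift f s hs (algebraMap ℤ_[3] Zomega a) = f a :=
  AdjoinRoot.lift_of _

theorem Zomega.exists_coords (x : Zomega) :
    ∃ a b : ℤ_[3], x = algebraMap _ _ a + algebraMap _ _ b * omega3 := by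
  have key : ∀ p : Polynomial ℤ_[3], ∃ a b : ℤ_[3],
      aeval omega3 p = algebraMap _ _ a + algebraMap _ _ b * omega3 := by
    intro p
    induction p using Polynomial.induction_on with
    | C a => exact ⟨a, 0, by simp⟩
    | add p q hp hq =>
      obtain ⟨a, b, h⟩ := hp
      obtain ⟨c, d, h'⟩ := hq
      exact ⟨a + c, b + d, by rw [map_add, h, h', map_add, map_add]; ring⟩
    | monomial n r h =>
      obtain ⟨a, b, h⟩ := h
      refine ⟨-b, a - b, ?_⟩
      rw [pow_succ, ← mul_assoc, map_mul, h, aeval_X, map_neg, map_sub]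
      linear_combination algebraMap ℤ_[3] Zomega b * omega3_sq
  obtain ⟨p, hp⟩ := AdjoinRoot.mk_surjective (g := (X ^ 2 + X + 1 : Polynomial ℤ_[3])) x
  obtain ⟨a, b, h⟩ := key p
  refine ⟨a, b, ?_⟩
  rw [← h, ← hp]
  exact (AdjoinRoot.aeval_eq p).symm

theorem PadicInt.three_dvd_of_toZMod_eq_zero {a : ℤ_[3]} (h : PadicInt.toZMod a = 0) : 3 ∣ a := by
  have h' : a ∈ RingHom.ker (PadicInt.toZMod (p := 3)) := h
  rw [PadicInt.ker_toZMod, PadicInt.maximalIdeal_eq_span_p, Ideal.mem_span_singleton] at h'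
  exact_mod_cast h'

theorem PadicInt.isUnit_of_toZMod_ne_zero {a : ℤ_[3]} (h : PadicInt.toZMod a ≠ 0) : IsUnit a := by
  by_contra hu
  have h' : a ∈ RingHom.ker (PadicInt.toZMod (p := 3)) := by
    rwa [PadicInt.ker_toZMod, IsLocalRing.mem_maximalIdeal]
  exact h h'

theorem PadicInt.exists_three_dvd_sub (a : ℤ_[3]) : ∃ j : ℕ, 3 ∣ a - j :=
  ⟨(PadicInt.toZMod a).val, three_dvd_of_toZMod_eq_zero (by rw [map_sub, map_natCast, ZMod.natCast_zmod_val, sub_self])⟩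

/-- Reduction modulo `9`, from `R` to `(ℤ/9)[ω]`. -/
noncomputable def Zomega.reduceNine : Zomega →+* QuadraticAlgebra (ZMod 9) (-1) (-1) :=
  Zomega.lift ((algebraMap (ZMod 9) (QuadraticAlgebra (ZMod 9) (-1) (-1))).comp
    (PadicInt.toZModPow (p := 3) 2)) ⟨0, 1⟩ (by ext <;> simp [pow_two, QuadraticAlgebra.re_one, QuadraticAlgebra.im_one])

theorem H6.im_reduceNine_eq_zero {u : Zomegaˣ} (hu : u ∈ H6) :
    (Zomega.reduceNine u).im = 0 := by
  induction hu using Subgroup.closure_induction with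
  | mem u hu =>
    rcases hu with ⟨c, rfl⟩ | ⟨x, hx⟩
    · simp [Zomega.reduceNine]
    · have h9 : (9 : QuadraticAlgebra (ZMod 9) (-1) (-1)) = 0 := by
        ext <;> simp <;> decide
      rw [hx, map_add, map_mul, map_one, map_ofNat, h9, zero_mul, add_zero,
        QuadraticAlgebra.im_one]
  | one => simp [QuadraticAlgebra.im_one]
  | mul u v _ _ hu hv => simp [hu, hv]
  | inv u _ hu =>
    have h : Zomega.reduceNine u * Zomega.reduceNine (u⁻¹ : Zomegaˣ) = 1 := by
      rw [← map_mul, Units.mul_inv, map_one]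
    have hre := congrArg QuadraticAlgebra.re h
    have him := congrArg QuadraticAlgebra.im h
    simp only [QuadraticAlgebra.re_mul, QuadraticAlgebra.im_mul, hu, QuadraticAlgebra.re_one,
      QuadraticAlgebra.im_one] at hre him
    set x := (Zomega.reduceNine u).re
    set y := (Zomega.reduceNine (u⁻¹ : Zomegaˣ)).re
    linear_combination y * him - (Zomega.reduceNine (u⁻¹ : Zomegaˣ)).im * hre

theorem H6.algebraMap_mem {u : Zomegaˣ} {c : ℤ_[3]} (hc : IsUnit c)
    (h : (u : Zomega) = algebraMap _ _ c) : u ∈ H6 :=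
  Subgroup.subset_closure (Or.inl ⟨hc.unit, Units.ext (by simp [h])⟩)

theorem H6.one_add_nine_mem {u : Zomegaˣ} {x : Zomega} (h : (u : Zomega) = 1 + 9 * x) : u ∈ H6 :=
  Subgroup.subset_closure (Or.inr ⟨x, h⟩)

/-- Units congruent modulo `9R` up to a factor in `ℤ₃^×` have the same class. -/
theorem H6.mk_eq_mk {u v : Zomegaˣ} {c : ℤ_[3]} (hc : IsUnit c) {x : Zomega}
    (h : (v : Zomega) = algebraMap _ _ c * u + 9 * x) :
    (QuotientGroup.mk u : Zomegaˣ ⧸ H6) = QuotientGroup.mk v := by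
  rw [QuotientGroup.eq]
  let d : Zomegaˣ := Units.map (algebraMap ℤ_[3] Zomega : ℤ_[3] →* Zomega) hc.unit
  have hd : (d : Zomega) = algebraMap _ _ c := by simp [d]
  have h1 : d⁻¹ * (u⁻¹ * v) ∈ H6 := by
    refine H6.one_add_nine_mem (x := (d⁻¹ : Zomegaˣ) * (u⁻¹ : Zomegaˣ) * x) ?_
    simp only [Units.val_mul, h, ← hd]
    linear_combination (u * (u⁻¹ : Zomegaˣ) : Zomega) * d.inv_mul + u.inv_mul
  simpa using mul_mem (H6.algebraMap_mem hc hd) h1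

theorem H6.exists_mk_eq_pow_of_dvd {t u : Zomegaˣ} (ht : (t : Zomega) = 1 + 3 * omega3)
    {a b : ℤ_[3]} (hu : (u : Zomega) = algebraMap _ _ a + algebraMap _ _ b * omega3)
    (ha : IsUnit a) (hb : 3 ∣ b) :
    ∃ j : ℕ, (QuotientGroup.mk u : Zomegaˣ ⧸ H6) = QuotientGroup.mk t ^ j := by
  obtain ⟨b, rfl⟩ := hb
  obtain ⟨e, he⟩ := ha.exists_right_inv
  obtain ⟨j, c, hj⟩ := PadicInt.exists_three_dvd_sub (e * b)
  have hpow : ∀ j : ℕ, ∃ x : Zomega, (t : Zomega) ^ j = 1 + 3 * j * omega3 + 9 * x := by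
    intro j
    induction j with
    | zero => exact ⟨0, by simp⟩
    | succ j ih =>
      obtain ⟨x, hx⟩ := ih
      refine ⟨j * omega3 ^ 2 + x * (1 + 3 * omega3), ?_⟩
      rw [pow_succ, hx, ht]
      push_cast
      ring
  obtain ⟨x, hx⟩ := hpow j
  refine ⟨j, ?_⟩
  rw [← QuotientGroup.mk_pow]
  refine (H6.mk_eq_mk ha (x := algebraMap _ _ a * (algebraMap _ _ c * omega3 - x)) ?_).symm
  have hj' := congrArg (algebraMap ℤ_[3] Zomega) hj
  have he' := congrArg (algebraMap ℤ_[3] Zomega) he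
  simp only [map_sub, map_mul, map_natCast, map_ofNat, map_one] at hj' he'
  rw [hu, Units.val_pow_eq_pow_val, hx, map_mul, map_ofNat]
  linear_combination 3 * algebraMap ℤ_[3] Zomega a * omega3 * hj' -
    3 * algebraMap ℤ_[3] Zomega b * omega3 * he'

theorem H6.exists_mk_eq_pow_mul_pow {w t : Zomegaˣ} (hw : (w : Zomega) = omega3)
    (ht : (t : Zomega) = 1 + 3 * omega3) (u : Zomegaˣ) :
    ∃ i j : ℕ, (QuotientGroup.mk u : Zomegaˣ ⧸ H6) =
      QuotientGroup.mk w ^ i * QuotientGroup.mk t ^ j := by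
  obtain ⟨a, b, hu⟩ := Zomega.exists_coords u
  have hw3 : w ^ 3 = 1 := by
    ext
    push_cast
    rw [hw]
    linear_combination (omega3 - 1) * omega3_sq
  have hab : PadicInt.toZMod a + PadicInt.toZMod b ≠ 0 := by
    have h := u.isUnit.map (Zomega.lift (PadicInt.toZMod (p := 3)) 1 (by decide))
    simpa [hu] using h.ne_zero
  have hcases : ∀ x y : ZMod 3, x + y ≠ 0 →
      (x ≠ 0 ∧ y = 0) ∨ (y - x ≠ 0 ∧ -x = 0) ∨ (-y ≠ 0 ∧ x - y = 0) := by decide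
  rcases hcases _ _ hab with ⟨h1, h2⟩ | ⟨h1, h2⟩ | ⟨h1, h2⟩
  · obtain ⟨j, hj⟩ := H6.exists_mk_eq_pow_of_dvd ht hu (PadicInt.isUnit_of_toZMod_ne_zero h1)
      (PadicInt.three_dvd_of_toZMod_eq_zero h2)
    exact ⟨0, j, by rw [hj, pow_zero, one_mul]⟩
  · rw [← map_sub] at h1
    rw [← map_neg] at h2
    obtain ⟨j, hj⟩ := H6.exists_mk_eq_pow_of_dvd (u := w ^ 2 * u) ht
      (by
        rw [map_sub, map_neg]
        simp only [Units.val_mul, Units.val_pow_eq_pow_val, hu, hw]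
        linear_combination (algebraMap ℤ_[3] Zomega a + algebraMap ℤ_[3] Zomega b * (omega3 - 1)) *
          omega3_sq)
      (PadicInt.isUnit_of_toZMod_ne_zero h1) (PadicInt.three_dvd_of_toZMod_eq_zero h2)
    refine ⟨1, j, ?_⟩
    rw [← hj, pow_one, ← QuotientGroup.mk_mul, ← mul_assoc, ← pow_succ', hw3, one_mul]
  · rw [← map_neg] at h1
    rw [← map_sub] at h2
    obtain ⟨j, hj⟩ := H6.exists_mk_eq_pow_of_dvd (u := w * u) ht
      (by
        rw [map_sub, map_neg]
        simp only [Units.val_mul, hu, hw]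
        linear_combination algebraMap ℤ_[3] Zomega b * omega3_sq)
      (PadicInt.isUnit_of_toZMod_ne_zero h1) (PadicInt.three_dvd_of_toZMod_eq_zero h2)
    refine ⟨2, j, ?_⟩
    rw [← hj, ← QuotientGroup.mk_pow, ← QuotientGroup.mk_mul, ← mul_assoc, ← pow_succ, hw3, one_mul]

/-- The homomorphism `(i, j) ↦ xⁱyʲ` given by two elements of exponent `n`. -/
def zmodProdPowHom {G : Type*} [CommGroup G] {n : ℕ} [NeZero n] {x y : G} (hx : x ^ n = 1)
    (hy : y ^ n = 1) : Multiplicative (ZMod n × ZMod n) →* G where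
  toFun p := x ^ p.toAdd.1.val * y ^ p.toAdd.2.val
  map_one' := by simp
  map_mul' p q := by
    simp only [toAdd_mul, Prod.fst_add, Prod.snd_add, ZMod.val_add]
    rw [← pow_eq_pow_mod _ hx, ← pow_eq_pow_mod _ hy, pow_add, pow_add, mul_mul_mul_comm]

/-- `R^× / ⟨ℤ₃^×, 1 + 9R⟩ ≅ ℤ/3 × ℤ/3`, generated by the classes of `ω` and `1 + 3ω`. -/
theorem stmt_6 (w t : Zomegaˣ) (hw : (w : Zomega) = omega3)
    (ht : (t : Zomega) = 1 + 3 * omega3) :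
    Nonempty ((Zomegaˣ ⧸ H6) ≃* Multiplicative (ZMod 3 × ZMod 3)) ∧
    Subgroup.closure {(QuotientGroup.mk w : Zomegaˣ ⧸ H6), QuotientGroup.mk t} = ⊤ := by
  have hw3 : (QuotientGroup.mk w : Zomegaˣ ⧸ H6) ^ 3 = 1 := by
    rw [← QuotientGroup.mk_pow, QuotientGroup.eq_one_iff]
    refine H6.one_add_nine_mem (x := 0) ?_
    push_cast
    rw [hw]
    linear_combination (omega3 - 1) * omega3_sq
  have ht3 : (QuotientGroup.mk t : Zomegaˣ ⧸ H6) ^ 3 = 1 := by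
    rw [← QuotientGroup.mk_pow, QuotientGroup.eq_one_iff]
    refine H6.one_add_nine_mem (x := omega3 + 3 * omega3 ^ 2 + 3 * omega3 ^ 3) ?_
    push_cast
    rw [ht]
    ring
  refine ⟨⟨(MulEquiv.ofBijective (zmodProdPowHom (G := Zomegaˣ ⧸ H6) hw3 ht3) ⟨?_, ?_⟩).symm⟩, ?_⟩
  · rw [injective_iff_map_eq_one]
    intro p hp
    have hmem : w ^ p.toAdd.1.val * t ^ p.toAdd.2.val ∈ H6 := by
      rw [← QuotientGroup.eq_one_iff]
      exact hp
    have him := H6.im_reduceNine_eq_zero hmem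
    have hω : Zomega.reduceNine omega3 = ⟨0, 1⟩ := Zomega.lift_omega3 _ _ _
    push_cast at him
    rw [hw, ht, map_mul, map_pow, map_pow, map_add, map_mul, map_one, map_ofNat, hω] at him
    have key : ∀ i j : ZMod 3, ((⟨0, 1⟩ ^ i.val * (1 + 3 * ⟨0, 1⟩) ^ j.val :
        QuadraticAlgebra (ZMod 9) (-1) (-1))).im = 0 → i = 0 ∧ j = 0 := by
      decide
    obtain ⟨h1, h2⟩ := key _ _ him
    exact Multiplicative.toAdd.injective (Prod.ext h1 h2)
  · intro q
    obtain ⟨u, rfl⟩ := QuotientGroup.mk_surjective q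
    obtain ⟨i, j, h⟩ := H6.exists_mk_eq_pow_mul_pow hw ht u
    refine ⟨Multiplicative.ofAdd ((i : ZMod 3), (j : ZMod 3)), ?_⟩
    simp only [zmodProdPowHom, MonoidHom.coe_mk, OneHom.coe_mk, toAdd_ofAdd, ZMod.val_natCast]
    rw [← pow_eq_pow_mod _ hw3, ← pow_eq_pow_mod _ ht3, h]
  · rw [eq_top_iff]
    rintro q -
    obtain ⟨u, rfl⟩ := QuotientGroup.mk_surjective q
    obtain ⟨i, j, h⟩ := H6.exists_mk_eq_pow_mul_pow hw ht u
    rw [h]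
    exact mul_mem (pow_mem (Subgroup.subset_closure (by simp)) i)
      (pow_mem (Subgroup.subset_closure (by simp)) j)
end

section
/- The quotient group R^×/(1 + 9R) is isomorphic to ℤ/2ℤ × ℤ/3ℤ × ℤ/3ℤ × ℤ/3ℤ, and it is generated by the classes of −1, 1 + √−3, 1 − √−3 and 1 + 3√−3, where √−3 := 1 + 2ω ∈ R; in particular the classes of 1 + √−3, 1 − √−3 and 1 + 3√−3 each have order 3 and generate a subgroup isomorphic to (ℤ/3ℤ)³. -/
open Polynomial

/-- `√-3 = 1 + 2ω` in `R`. -/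
noncomputable def sqrtNeg3 : Zomega := 1 + 2 * omega3

/-- The subgroup `1 + 9R` of `R^×`. -/
noncomputable def U9 : Subgroup Zomegaˣ where
  carrier := {u : Zomegaˣ | ∃ x : Zomega, (u : Zomega) = 1 + 9 * x}
  one_mem' := ⟨0, by simp⟩
  mul_mem' := by
    rintro a b ⟨x, hx⟩ ⟨y, hy⟩
    exact ⟨x + y + 9 * x * y, by rw [Units.val_mul, hx, hy]; ring⟩
  inv_mem' := by
    rintro a ⟨x, hx⟩
    refine ⟨-(x * ((a⁻¹ : Zomegaˣ) : Zomega)), ?_⟩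
    have h : ((a : Zomega)) * ((a⁻¹ : Zomegaˣ) : Zomega) = 1 := a.mul_inv
    rw [hx] at h
    linear_combination h

namespace Zomega

/-- The finite ring `(ℤ/9)[ω]`, a computable model of `R/9R`. -/
abbrev ModNine : Type := QuadraticAlgebra (ZMod 9) (-1) (-1)

/-- Reduction modulo `9` on `ℤ₃`. -/
noncomputable def padicModNine : ℤ_[3] →+* ZMod 9 := PadicInt.toZModPow 2

/-- Reduction modulo `9` on `R`. -/
noncomputable def modNine : Zomega →+* ModNine :=
  AdjoinRoot.lift ((algebraMap (ZMod 9) ModNine).comp padicModNine) ⟨0, 1⟩ (by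
    simp only [eval₂_add, eval₂_pow, eval₂_X, eval₂_one]
    decide)

/-- The inclusion of `ℤ₃` in `R`. -/
noncomputable def ofPadic : ℤ_[3] →+* Zomega :=
  AdjoinRoot.of (X ^ 2 + X + 1 : Polynomial ℤ_[3])

theorem modNine_ofPadic (x : ℤ_[3]) :
    modNine (ofPadic x) = algebraMap (ZMod 9) ModNine (padicModNine x) :=
  AdjoinRoot.lift_of _

theorem modNine_omega3 : modNine omega3 = ⟨0, 1⟩ :=
  AdjoinRoot.lift_root _

theorem exists_eq_add_mul_omega3 (z : Zomega) :
    ∃ x y : ℤ_[3], z = ofPadic x + ofPadic y * omega3 := by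
  obtain ⟨g, rfl⟩ := AdjoinRoot.mk_surjective (g := (X ^ 2 + X + 1 : Polynomial ℤ_[3])) z
  have hdeg : (X ^ 2 + X + 1 : Polynomial ℤ_[3]).natDegree = 2 := by compute_degree!
  have hmonic : (X ^ 2 + X + 1 : Polynomial ℤ_[3]).Monic := by monicity!
  have hlt := natDegree_modByMonic_lt g hmonic (by
    intro h
    simp [h] at hdeg)
  obtain ⟨y, x, hxy⟩ :=
    exists_eq_X_add_C_of_natDegree_le_one (p := g %ₘ (X ^ 2 + X + 1)) (by omega)
  refine ⟨x, y, ?_⟩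
  have hmod : AdjoinRoot.mk (X ^ 2 + X + 1 : Polynomial ℤ_[3]) g =
      AdjoinRoot.mk _ (C y * X + C x) := by
    rw [← hxy, AdjoinRoot.mk_eq_mk, modByMonic_eq_sub_mul_div, sub_sub_cancel]
    exact dvd_mul_right _ _
  rw [map_add, map_mul, AdjoinRoot.mk_X, AdjoinRoot.mk_C, AdjoinRoot.mk_C] at hmod
  exact hmod.trans (add_comm _ _)

theorem modNine_add_mul_omega3 (x y : ℤ_[3]) :
    modNine (ofPadic x + ofPadic y * omega3) = ⟨padicModNine x, padicModNine y⟩ := by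
  rw [map_add, map_mul, modNine_omega3, modNine_ofPadic, modNine_ofPadic]
  ext <;> simp [QuadraticAlgebra.algebraMap_eq]

theorem padicModNine_eq_zero {x : ℤ_[3]} (h : padicModNine x = 0) : (9 : ℤ_[3]) ∣ x := by
  have hx : x ∈ RingHom.ker (PadicInt.toZModPow 2 : ℤ_[3] →+* ZMod (3 ^ 2)) := h
  rw [PadicInt.ker_toZModPow, Ideal.mem_span_singleton] at hx
  norm_num at hx
  exact hx

theorem modNine_eq_zero_iff {z : Zomega} : modNine z = 0 ↔ 9 ∣ z := by
  constructor
  · intro h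
    obtain ⟨x, y, rfl⟩ := exists_eq_add_mul_omega3 z
    rw [modNine_add_mul_omega3, QuadraticAlgebra.ext_iff] at h
    have hx := map_dvd ofPadic (padicModNine_eq_zero h.1)
    have hy := map_dvd ofPadic (padicModNine_eq_zero h.2)
    rw [map_ofNat] at hx hy
    exact dvd_add hx (hy.mul_right _)
  · rintro ⟨w, rfl⟩
    rw [map_mul, map_ofNat, show (OfNat.ofNat 9 : ModNine) = 0 by decide, zero_mul]

theorem mem_U9_iff {u : Zomegaˣ} : u ∈ U9 ↔ modNine u = 1 := by
  rw [← sub_eq_zero, ← map_one modNine, ← map_sub, modNine_eq_zero_iff]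
  exact exists_congr fun x => sub_eq_iff_eq_add'.symm

/-- The map `R^×/(1 + 9R) → (ℤ/9)[ω]` induced by reduction modulo `9`. -/
noncomputable def quotientModNine : Zomegaˣ ⧸ U9 →* ModNine :=
  QuotientGroup.lift U9 ((modNine : Zomega →* ModNine).comp (Units.coeHom Zomega))
    fun _ hu => mem_U9_iff.1 hu

theorem quotientModNine_mk (u : Zomegaˣ) : quotientModNine (QuotientGroup.mk u) = modNine u :=
  rfl

theorem quotientModNine_injective : Function.Injective quotientModNine := by
  rw [injective_iff_map_eq_one]
  intro q
  induction q using QuotientGroup.induction_on with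
  | H u => exact fun h => (QuotientGroup.eq_one_iff u).2 (mem_U9_iff.2 h)

theorem three_not_dvd_of_isUnit {x y : ZMod 9} (h : IsUnit (⟨x, y⟩ : ModNine)) :
    (x + y).val % 3 ≠ 0 := by
  obtain ⟨z, hz⟩ := h.exists_right_inv
  have hre : x * z.re - y * z.im = 1 := by
    simpa [QuadraticAlgebra.re_one, sub_eq_add_neg] using congrArg QuadraticAlgebra.re hz
  have him : x * z.im + y * z.re - y * z.im = 0 := by
    simpa [QuadraticAlgebra.im_one, sub_eq_add_neg] using congrArg QuadraticAlgebra.im hz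
  intro hxy
  have hdvd : ∀ t : ZMod 9, t.val % 3 = 0 → ∃ m, t = 3 * m := by decide
  obtain ⟨m, hm⟩ := hdvd _ hxy
  have hone : ∀ w : ZMod 9, 3 * w ≠ 1 := by decide
  apply hone (m * (z.re + z.im) - y * z.im)
  linear_combination -(z.re + z.im) * hm + hre + him

theorem exists_eq_pow_mul_of_isUnit {z : ModNine} (hz : IsUnit z) :
    ∃ (i : ZMod 2) (j k l : ZMod 3),
      (-1) ^ i.val * (⟨2, 2⟩ ^ j.val * (⟨0, 7⟩ ^ k.val * ⟨4, 6⟩ ^ l.val)) = z := by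
  have key : ∀ x y : ZMod 9, (x + y).val % 3 ≠ 0 → ∃ (i : ZMod 2) (j k l : ZMod 3),
      (-1) ^ i.val * (⟨2, 2⟩ ^ j.val * (⟨0, 7⟩ ^ k.val * ⟨4, 6⟩ ^ l.val)) =
        (⟨x, y⟩ : ModNine) := by decide +kernel
  exact key z.re z.im (three_not_dvd_of_isUnit hz)

theorem eq_zero_of_pow_mul_eq_one : ∀ (i : ZMod 2) (j k l : ZMod 3),
    (-1) ^ i.val * (⟨2, 2⟩ ^ j.val * (⟨0, 7⟩ ^ k.val * ⟨4, 6⟩ ^ l.val)) = (1 : ModNine) →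
      i = 0 ∧ j = 0 ∧ k = 0 ∧ l = 0 := by
  decide +kernel

/-- The homomorphism `ℤ/n → G` sending `1` to an element `g` with `g ^ n = 1`. -/
def zmodHom {G : Type*} [CommGroup G] {n : ℕ} {g : G} (hg : g ^ n = 1) :
    ZMod n →+ Additive G :=
  ZMod.lift n ⟨zmultiplesHom (Additive G) (Additive.ofMul g), by simp [← ofMul_pow, hg]⟩

theorem zmodHom_apply {G : Type*} [CommGroup G] {n : ℕ} [NeZero n] {g : G} (hg : g ^ n = 1)
    (i : ZMod n) : zmodHom hg i = Additive.ofMul (g ^ i.val) := by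
  have h := ZMod.lift_coe n ⟨zmultiplesHom (Additive G) (Additive.ofMul g),
    by simp [← ofMul_pow, hg]⟩ (i.val : ℤ)
  rw [Int.cast_natCast, ZMod.natCast_zmod_val] at h
  exact h.trans (natCast_zsmul _ _)

/-- The homomorphism `ℤ/2 × (ℤ/3)³ → G` with prescribed values on the four standard generators. -/
def powProdHom {G : Type*} [CommGroup G] {a b c d : G}
    (ha : a ^ 2 = 1) (hb : b ^ 3 = 1) (hc : c ^ 3 = 1) (hd : d ^ 3 = 1) :
    Multiplicative (ZMod 2 × ZMod 3 × ZMod 3 × ZMod 3) →* G :=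
  AddMonoidHom.toMultiplicativeLeft
    ((zmodHom ha).coprod ((zmodHom hb).coprod ((zmodHom hc).coprod (zmodHom hd))))

theorem powProdHom_ofAdd {G : Type*} [CommGroup G] {a b c d : G}
    (ha : a ^ 2 = 1) (hb : b ^ 3 = 1) (hc : c ^ 3 = 1) (hd : d ^ 3 = 1)
    (i : ZMod 2) (j k l : ZMod 3) :
    powProdHom ha hb hc hd (Multiplicative.ofAdd (i, j, k, l)) =
      a ^ i.val * (b ^ j.val * (c ^ k.val * d ^ l.val)) := by
  simp [powProdHom, zmodHom_apply]

/-- If `a`, `b`, `c`, `d` are killed by `2`, `3`, `3`, `3` and every element of `G` is uniquely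
a product of their powers, then `G` is the corresponding product of cyclic groups. -/
theorem structure_of_powProdHom_bijective {G : Type*} [CommGroup G] {a b c d : G}
    (ha : a ^ 2 = 1) (hb : b ^ 3 = 1) (hc : c ^ 3 = 1) (hd : d ^ 3 = 1)
    (hbij : Function.Bijective (powProdHom ha hb hc hd)) :
    Nonempty (G ≃* Multiplicative (ZMod 2 × ZMod 3 × ZMod 3 × ZMod 3)) ∧
    Subgroup.closure {a, b, c, d} = ⊤ ∧ orderOf b = 3 ∧ orderOf c = 3 ∧ orderOf d = 3 ∧
    Nonempty (Subgroup.closure {b, c, d} ≃* Multiplicative (ZMod 3 × ZMod 3 × ZMod 3)) := by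
  have hne : ∀ j k l : ZMod 3, (j, k, l) ≠ 0 → b ^ j.val * (c ^ k.val * d ^ l.val) ≠ 1 := by
    intro j k l h h1
    have := (injective_iff_map_eq_one _).1 hbij.1 (Multiplicative.ofAdd (0, j, k, l))
      (by rw [powProdHom_ofAdd, ZMod.val_zero, pow_zero, one_mul, h1])
    exact h (congrArg Prod.snd (Multiplicative.ofAdd.injective this))
  have hval : ((1 : ZMod 3).val) = 1 := rfl
  refine ⟨⟨(MulEquiv.ofBijective _ hbij).symm⟩, ?_, ?_, ?_, ?_, ?_⟩
  · rw [eq_top_iff]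
    intro g _
    obtain ⟨⟨i, j, k, l⟩, rfl⟩ := hbij.2 g
    have hmem : ∀ x ∈ ({a, b, c, d} : Set G), ∀ n : ℕ, x ^ n ∈ Subgroup.closure {a, b, c, d} :=
      fun x hx n => pow_mem (Subgroup.subset_closure hx) n
    refine (powProdHom_ofAdd ha hb hc hd i j k l).symm ▸ ?_
    exact mul_mem (hmem a (by simp) _) (mul_mem (hmem b (by simp) _)
      (mul_mem (hmem c (by simp) _) (hmem d (by simp) _)))
  · exact orderOf_eq_prime hb (by simpa [hval] using hne 1 0 0 (by decide))
  · exact orderOf_eq_prime hc (by simpa [hval] using hne 0 1 0 (by decide))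
  · exact orderOf_eq_prime hd (by simpa [hval] using hne 0 0 1 (by decide))
  · let φ : Multiplicative (ZMod 3 × ZMod 3 × ZMod 3) →* G :=
      (powProdHom ha hb hc hd).comp
        (AddMonoidHom.toMultiplicative (AddMonoidHom.inr (ZMod 2) (ZMod 3 × ZMod 3 × ZMod 3)))
    have hφ : ∀ j k l, φ (Multiplicative.ofAdd (j, k, l)) = b ^ j.val * (c ^ k.val * d ^ l.val) := by
      intro j k l
      refine (powProdHom_ofAdd ha hb hc hd 0 j k l).trans ?_
      rw [ZMod.val_zero, pow_zero, one_mul]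
    have hinj : Function.Injective φ := by
      rw [injective_iff_map_eq_one]
      rintro ⟨j, k, l⟩ h
      by_contra h0
      exact hne j k l h0 ((hφ j k l).symm.trans h)
    have hrange : φ.range = Subgroup.closure {b, c, d} := by
      apply le_antisymm
      · rintro _ ⟨⟨j, k, l⟩, rfl⟩
        have hmem : ∀ x ∈ ({b, c, d} : Set G), ∀ n : ℕ, x ^ n ∈ Subgroup.closure {b, c, d} :=
          fun x hx n => pow_mem (Subgroup.subset_closure hx) n
        refine (hφ j k l).symm ▸ ?_
        exact mul_mem (hmem b (by simp) _) (mul_mem (hmem c (by simp) _) (hmem d (by simp) _))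
      · rw [Subgroup.closure_le]
        rintro x (rfl | rfl | rfl)
        · exact ⟨Multiplicative.ofAdd (1, 0, 0), by simp [hφ, hval]⟩
        · exact ⟨Multiplicative.ofAdd (0, 1, 0), by simp [hφ, hval]⟩
        · exact ⟨Multiplicative.ofAdd (0, 0, 1), by simp [hφ, hval]⟩
    exact ⟨((MonoidHom.ofInjective hinj).trans (MulEquiv.subgroupCongr hrange)).symm⟩

end Zomega

open Zomega

/-- `R^×/(1 + 9R) ≅ ℤ/2 × ℤ/3 × ℤ/3 × ℤ/3`, generated by the classes of `-1`,
`1 + √-3`, `1 - √-3` and `1 + 3√-3`; the latter three classes each have order `3`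
and generate a subgroup isomorphic to `(ℤ/3)³`. -/
theorem stmt_7 (a b c d : Zomegaˣ)
    (ha : (a : Zomega) = -1) (hb : (b : Zomega) = 1 + sqrtNeg3)
    (hc : (c : Zomega) = 1 - sqrtNeg3) (hd : (d : Zomega) = 1 + 3 * sqrtNeg3) :
    Nonempty ((Zomegaˣ ⧸ U9) ≃* Multiplicative (ZMod 2 × ZMod 3 × ZMod 3 × ZMod 3)) ∧
    Subgroup.closure {(QuotientGroup.mk a : Zomegaˣ ⧸ U9), QuotientGroup.mk b,
      QuotientGroup.mk c, QuotientGroup.mk d} = ⊤ ∧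
    orderOf (QuotientGroup.mk b : Zomegaˣ ⧸ U9) = 3 ∧
    orderOf (QuotientGroup.mk c : Zomegaˣ ⧸ U9) = 3 ∧
    orderOf (QuotientGroup.mk d : Zomegaˣ ⧸ U9) = 3 ∧
    Nonempty ((Subgroup.closure {(QuotientGroup.mk b : Zomegaˣ ⧸ U9),
      QuotientGroup.mk c, QuotientGroup.mk d} : Subgroup (Zomegaˣ ⧸ U9)) ≃*
        Multiplicative (ZMod 3 × ZMod 3 × ZMod 3)) := by
  have ha' : modNine a = -1 := by rw [ha, map_neg, map_one]
  have hb' : modNine b = ⟨2, 2⟩ := by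
    rw [hb, sqrtNeg3, map_add, map_add, map_mul, map_one, map_ofNat, modNine_omega3]
    decide
  have hc' : modNine c = ⟨0, 7⟩ := by
    rw [hc, sqrtNeg3, map_sub, map_add, map_mul, map_one, map_ofNat, modNine_omega3]
    decide
  have hd' : modNine d = ⟨4, 6⟩ := by
    rw [hd, sqrtNeg3, map_add, map_mul, map_add, map_mul, map_one, map_ofNat, map_ofNat,
      modNine_omega3]
    decide
  have hpow : ∀ (u : Zomegaˣ) (n : ℕ), modNine u ^ n = 1 →
      (QuotientGroup.mk u : Zomegaˣ ⧸ U9) ^ n = 1 := fun u n h =>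
    quotientModNine_injective (by rw [map_pow, quotientModNine_mk, h, map_one])
  have ha2 := hpow a 2 (by rw [ha']; decide)
  have hb3 := hpow b 3 (by rw [hb']; decide)
  have hc3 := hpow c 3 (by rw [hc']; decide)
  have hd3 := hpow d 3 (by rw [hd']; decide)
  have hval : ∀ (i : ZMod 2) (j k l : ZMod 3),
      quotientModNine (powProdHom ha2 hb3 hc3 hd3 (Multiplicative.ofAdd (i, j, k, l))) =
        (-1) ^ i.val * (⟨2, 2⟩ ^ j.val * (⟨0, 7⟩ ^ k.val * ⟨4, 6⟩ ^ l.val)) := by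
    intro i j k l
    simp only [powProdHom_ofAdd, map_mul, map_pow, quotientModNine_mk, ha', hb', hc', hd']
  refine structure_of_powProdHom_bijective (G := Zomegaˣ ⧸ U9) ha2 hb3 hc3 hd3 ⟨?_, fun q => ?_⟩
  · rw [injective_iff_map_eq_one]
    rintro ⟨i, j, k, l⟩ h
    obtain ⟨rfl, rfl, rfl, rfl⟩ := eq_zero_of_pow_mul_eq_one i j k l
      ((hval i j k l).symm.trans ((congrArg quotientModNine h).trans (map_one _)))
    rfl
  · obtain ⟨i, j, k, l, h⟩ := exists_eq_pow_mul_of_isUnit ((Group.isUnit q).map quotientModNine)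
    exact ⟨Multiplicative.ofAdd (i, j, k, l), quotientModNine_injective ((hval i j k l).trans h)⟩
end
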